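/- arXiv:1610.07335 — 9 statements merged into one kernel-verified Lean document; each statement's English description precedes it below -/
import Mathlib

section
/- Let S ⊂ ℂⁿ be a finite set, let f be a holomorphic map defined on a neighbourhood of S with f(S) = {0} (a multigerm f : (ℂⁿ,S) → (ℂᵖ,0)), and let F(x,λ) = (f_λ(x), λ) be an r-parameter unfolding of f, defined near S×{0} ⊂ ℂⁿ×ℂʳ, which is infinitesimally stable. Then a holomorphic vector-field germ η̄ : (ℂᵖ,0) → ℂᵖ is liftable over f if and only if there exists a holomorphic vector-field germ η = (η₁,…,η_{p+r}) : (ℂ^{p+r},0) → ℂ^{p+r} liftable over F such that η_{p+j}(X,0) = 0 for all j = 1,…,r and all X near 0 ∈ ℂᵖ, and η̄(X) = (η₁(X,0),…,η_p(X,0)) for all X near 0. -/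
open Filter Topology

/-- If `M` is multilinear and `π` is linear, then `M (z, …, z) - M (π z, …, π z)` is the value at
`z - π z` of a linear form whose coefficients are homogeneous in `z`; this is that form. -/
noncomputable def ContinuousMultilinearMap.diffQuot {𝕜 E F : Type*} [NontriviallyNormedField 𝕜]
    [NormedAddCommGroup E] [NormedSpace 𝕜 E] [NormedAddCommGroup F] [NormedSpace 𝕜 F] {m : ℕ}
    (M : E [×(m + 1)]→L[𝕜] F) (π : E →L[𝕜] E) : E [×m]→L[𝕜] (E →L[𝕜] F) :=
  ∑ i : Fin (m + 1), ((M.compContinuousLinearMap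
    (fun k => if k < i then π else ContinuousLinearMap.id 𝕜 E)).curryMid i).flipMultilinear

section DiffQuot

variable {𝕜 E F : Type*} [NontriviallyNormedField 𝕜]
  [NormedAddCommGroup E] [NormedSpace 𝕜 E] [NormedAddCommGroup F] [NormedSpace 𝕜 F]

theorem ContinuousMultilinearMap.diffQuot_apply_sub {m : ℕ}
    (M : E [×(m + 1)]→L[𝕜] F) (π : E →L[𝕜] E) (z : E) :
    M.diffQuot π (fun _ => z) (z - π z) = M (fun _ => z) - M (fun _ => π z) := by
  let a : ℕ → Fin (m + 1) → E := fun i k => if (k : ℕ) < i then π z else z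
  have key : ∀ i : Fin (m + 1),
      (((M.compContinuousLinearMap
        (fun k => if k < i then π else ContinuousLinearMap.id 𝕜 E)).curryMid i).flipMultilinear)
        (fun _ => z) (z - π z) = M (a i) - M (a (i + 1)) := by
    intro i
    have h1 : (fun k : Fin (m + 1) => (if k < i then π else ContinuousLinearMap.id 𝕜 E)
        ((i.insertNth (z - π z) (fun _ => z) : Fin (m + 1) → E) k))
        = Function.update (a i) i (z - π z) := by
      funext k
      rcases eq_or_ne k i with rfl | hk
      · simp
      · obtain ⟨l, rfl⟩ := Fin.exists_succAbove_eq hk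
        rw [Function.update_of_ne hk, Fin.insertNth_apply_succAbove]
        simp only [a, Fin.lt_def]
        split_ifs <;> rfl
    have h2 : Function.update (a i) i z = a i := by
      conv_rhs => rw [← Function.update_eq_self i (a i)]
      simp [a]
    have h3 : Function.update (a i) i (π z) = a (i + 1) := by
      funext k
      rcases eq_or_ne k i with rfl | hk
      · simp [a]
      · rw [Function.update_of_ne hk]
        have : (k : ℕ) ≠ i := fun h => hk (Fin.ext h)
        have h' : (k : ℕ) < i ↔ (k : ℕ) < i + 1 := by omega
        simp only [a, h']
    change M (fun k : Fin (m + 1) => (if k < i then π else ContinuousLinearMap.id 𝕜 E)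
        ((i.insertNth (z - π z) (fun _ => z) : Fin (m + 1) → E) k)) = _
    rw [h1, M.map_update_sub, h2, h3]
  rw [diffQuot, _root_.sum_apply, _root_.sum_apply,
    Finset.sum_congr rfl (fun i _ => key i),
    Fin.sum_univ_eq_sum_range (fun i => M (a i) - M (a (i + 1))), Finset.sum_range_sub']
  have h0 : a 0 = fun _ => z := by simp [a]
  have hlast : a (m + 1) = fun _ => π z := funext fun k => if_pos k.isLt
  rw [h0, hlast]

theorem ContinuousMultilinearMap.norm_diffQuot_le {m : ℕ}
    (M : E [×(m + 1)]→L[𝕜] F) (π : E →L[𝕜] E) :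
    ‖M.diffQuot π‖ ≤ (m + 1) * (‖M‖ * (max ‖π‖ 1) ^ (m + 1)) := by
  have key : ∀ i : Fin (m + 1), ‖((M.compContinuousLinearMap
      (fun k => if k < i then π else ContinuousLinearMap.id 𝕜 E)).curryMid i).flipMultilinear‖ ≤
      ‖M‖ * (max ‖π‖ 1) ^ (m + 1) := by
    intro i
    set N := M.compContinuousLinearMap
      (fun k => if k < i then π else ContinuousLinearMap.id 𝕜 E)
    have hN : ‖N‖ ≤ ‖M‖ * (max ‖π‖ 1) ^ (m + 1) := by
      refine (M.norm_compContinuousLinearMap_le _).trans ?_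
      gcongr
      refine (Finset.prod_le_prod (fun _ _ => norm_nonneg _) (g := fun _ => max ‖π‖ 1) ?_).trans
        (by simp)
      intro k _
      split_ifs
      · exact le_max_left _ _
      · exact ContinuousLinearMap.norm_id_le.trans (le_max_right _ _)
    refine ContinuousMultilinearMap.opNorm_le_bound (by positivity) fun w => ?_
    refine ContinuousLinearMap.opNorm_le_bound _ (by positivity) fun v => ?_
    rw [ContinuousLinearMap.flipMultilinear_apply_apply]
    calc ‖N.curryMid i v w‖ ≤ ‖N.curryMid i v‖ * ∏ k, ‖w k‖ :=
          ContinuousMultilinearMap.le_opNorm _ _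
      _ ≤ (‖N.curryMid i‖ * ‖v‖) * ∏ k, ‖w k‖ := by
          gcongr
          exact ContinuousLinearMap.le_opNorm _ _
      _ ≤ ((‖M‖ * (max ‖π‖ 1) ^ (m + 1)) * ‖v‖) * ∏ k, ‖w k‖ := by
          rw [ContinuousMultilinearMap.norm_curryMid]
          gcongr
      _ = _ := by ring
  rw [diffQuot]
  refine (norm_sum_le (E := E [×m]→L[𝕜] (E →L[𝕜] F)) _ _).trans ?_
  refine (Finset.sum_le_sum fun i _ => key i).trans ?_
  simp

theorem AnalyticAt.clm_apply_of_analyticAt {G : Type*} [NormedAddCommGroup G] [NormedSpace 𝕜 G]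
    {A : G → E →L[𝕜] F} {v : G → E} {x : G} (hA : AnalyticAt 𝕜 A x) (hv : AnalyticAt 𝕜 v x) :
    AnalyticAt 𝕜 (fun y => A y (v y)) x :=
  ((ContinuousLinearMap.id 𝕜 (E →L[𝕜] F)).analyticAt_bilinear (A x, v x)).comp₂ hA hv

/-- Hadamard's lemma for analytic germs, relative to a linear map `π`. -/
theorem AnalyticAt.exists_diffQuot [CompleteSpace F] {g : E → F} {x : E}
    (hg : AnalyticAt 𝕜 g x) (π : E →L[𝕜] E) :
    ∃ Q : E → E →L[𝕜] F, AnalyticAt 𝕜 Q x ∧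
      ∀ᶠ z in 𝓝 x, g z - g (x + π (z - x)) = Q z (z - x - π (z - x)) := by
  obtain ⟨P, hP⟩ := hg
  let q : FormalMultilinearSeries 𝕜 E (E →L[𝕜] F) := fun m => (P (m + 1)).diffQuot π
  have hq : 0 < q.radius := by
    obtain ⟨C, r, hC, hr, hle⟩ := P.le_mul_pow_of_radius_pos hP.radius_pos
    set B : ℝ := max ‖π‖ 1
    have hB : 0 < B := lt_of_lt_of_le one_pos (le_max_right _ _)
    let ρ : NNReal := ⟨1 / (2 * (r * B)), by positivity⟩
    have hρ : 0 < ρ := by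
      rw [← NNReal.coe_pos]
      change 0 < 1 / (2 * (r * B))
      positivity
    refine lt_of_lt_of_le (ENNReal.coe_pos.2 hρ) (q.le_radius_of_bound (C * (r * B)) fun m => ?_)
    have hm : (m + 1 : ℝ) ≤ 2 ^ m := by exact_mod_cast Nat.lt_two_pow_self (n := m)
    calc ‖q m‖ * (ρ : ℝ) ^ m
        ≤ ((m + 1) * (C * r ^ (m + 1) * B ^ (m + 1))) * (1 / (2 * (r * B))) ^ m := by
          change _ * (1 / (2 * (r * B))) ^ m ≤ _
          gcongr
          refine ((P (m + 1)).norm_diffQuot_le π).trans ?_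
          gcongr
          exact hle _
      _ ≤ (2 ^ m * (C * r ^ (m + 1) * B ^ (m + 1))) * (1 / (2 * (r * B))) ^ m := by gcongr
      _ = C * (r * B) := by
          rw [div_pow, one_pow, mul_pow, mul_pow]
          field_simp
          ring
  have hQ : HasFPowerSeriesAt (fun z => q.sum (z - x)) q x := by
    have := (q.hasFPowerSeriesOnBall hq).hasFPowerSeriesAt.comp_sub x
    simpa using this
  refine ⟨fun z => q.sum (z - x), hQ.analyticAt, ?_⟩
  have h1 := hQ.eventually_hasSum_sub
  have h2 := hP.eventually_hasSum_sub
  have hlim : Tendsto (fun z => x + π (z - x)) (𝓝 x) (𝓝 x) := by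
    have : Continuous (fun z => x + π (z - x)) := by fun_prop
    simpa using this.tendsto x
  have h3 := hlim.eventually h2
  filter_upwards [h1, h2, h3] with z hz1 hz2 hz3
  have e1 := hz1.mapL (ContinuousLinearMap.apply 𝕜 F (z - x - π (z - x)))
  have e2 := hz2.sub hz3
  simp only [add_sub_cancel_left] at e2
  rw [← hasSum_nat_add_iff' 1] at e2
  have e0 : (P 0 fun _ => z - x) = P 0 fun _ => π (z - x) := congrArg _ (Subsingleton.elim _ _)
  simp only [Finset.range_one, Finset.sum_singleton, e0, sub_self, sub_zero] at e2
  refine e2.unique ?_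
  simpa only [q, ContinuousLinearMap.apply_apply,
    ContinuousMultilinearMap.diffQuot_apply_sub] using e1

end DiffQuot

/-- Germs prescribed at the points of a finite set are realized by a single function. -/
theorem Set.Finite.exists_eventuallyEq {X Y : Type*} [TopologicalSpace X] [T2Space X]
    {S : Set X} (hS : S.Finite) (Q : X → X → Y) :
    ∃ R : X → Y, ∀ s ∈ S, R =ᶠ[𝓝 s] Q s := by
  classical
  obtain ⟨U, hU, hd⟩ := hS.t2_separation
  refine ⟨fun z => if h : ∃ s ∈ S, z ∈ U s then Q h.choose z else Q z z, fun s hs => ?_⟩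
  filter_upwards [(hU s).2.mem_nhds (hU s).1] with z hz
  have h : ∃ s ∈ S, z ∈ U s := ⟨s, hs, hz⟩
  have : h.choose = s := hd.elim_set h.choose_spec.1 hs z h.choose_spec.2 hz
  simp only [dif_pos h, this]

/-- For a finite-singularity-type multigerm `f : (ℂⁿ,S) → (ℂᵖ,0)` with an
infinitesimally stable `r`-parameter unfolding `F(x,λ) = (f_λ(x),λ)`, a vector-field germ
`η̄` on `(ℂᵖ,0)` is liftable over `f` iff it arises from a vector field `η` liftable over `F`
whose last `r` components vanish on `Λ = 0`, via `η̄(X) = (η₁(X,0),…,η_p(X,0))`. -/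
theorem liftable_iff_of_stable_unfolding
    (n p r : ℕ) (S : Set (Fin n → ℂ)) (hSfin : S.Finite)
    (f : (Fin n → ℂ) → (Fin p → ℂ))
    (hf : ∀ s ∈ S, AnalyticAt ℂ f s) (hf0 : ∀ s ∈ S, f s = 0)
    (fhat : (Fin n → ℂ) × (Fin r → ℂ) → (Fin p → ℂ))
    (hfhat : ∀ s ∈ S, AnalyticAt ℂ fhat (s, 0))
    (hunf : ∀ x : Fin n → ℂ, fhat (x, 0) = f x)
    (F : (Fin n → ℂ) × (Fin r → ℂ) → (Fin p → ℂ) × (Fin r → ℂ))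
    (hF : ∀ q, F q = (fhat q, q.2))
    -- `F` is infinitesimally stable:
    (hstab : ∀ ν : (Fin n → ℂ) × (Fin r → ℂ) → (Fin p → ℂ) × (Fin r → ℂ),
      (∀ s ∈ S, AnalyticAt ℂ ν (s, 0)) →
      ∃ (ξ : (Fin n → ℂ) × (Fin r → ℂ) → (Fin n → ℂ) × (Fin r → ℂ))
        (η : (Fin p → ℂ) × (Fin r → ℂ) → (Fin p → ℂ) × (Fin r → ℂ)),
        (∀ s ∈ S, AnalyticAt ℂ ξ (s, 0)) ∧ AnalyticAt ℂ η 0 ∧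
        ∀ᶠ q in 𝓝ˢ (S ×ˢ ({0} : Set (Fin r → ℂ))),
          ν q = fderiv ℂ F q (ξ q) + η (F q))
    (ηbar : (Fin p → ℂ) → (Fin p → ℂ)) (hηbar : AnalyticAt ℂ ηbar 0) :
    -- `η̄` is liftable over `f` ...
    (∃ ξ : (Fin n → ℂ) → (Fin n → ℂ), (∀ s ∈ S, AnalyticAt ℂ ξ s) ∧
        ∀ᶠ x in 𝓝ˢ S, fderiv ℂ f x (ξ x) = ηbar (f x)) ↔
    -- ... iff it comes from a vector field liftable over `F` with last `r` components
    -- vanishing on `{Λ = 0}`: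
    (∃ η : (Fin p → ℂ) × (Fin r → ℂ) → (Fin p → ℂ) × (Fin r → ℂ),
        AnalyticAt ℂ η 0 ∧
        (∃ ξ : (Fin n → ℂ) × (Fin r → ℂ) → (Fin n → ℂ) × (Fin r → ℂ),
          (∀ s ∈ S, AnalyticAt ℂ ξ (s, 0)) ∧
          ∀ᶠ q in 𝓝ˢ (S ×ˢ ({0} : Set (Fin r → ℂ))),
            fderiv ℂ F q (ξ q) = η (F q)) ∧
        (∀ᶠ X in 𝓝 (0 : Fin p → ℂ), (η (X, 0)).2 = 0) ∧
        (∀ᶠ X in 𝓝 (0 : Fin p → ℂ), ηbar X = (η (X, 0)).1)) := by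
  obtain rfl : F = fun q => (fhat q, q.2) := funext hF
  clear hF
  set F : (Fin n → ℂ) × (Fin r → ℂ) → (Fin p → ℂ) × (Fin r → ℂ) := fun q => (fhat q, q.2)
    with hFdef
  have hFan : ∀ s ∈ S, AnalyticAt ℂ F (s, 0) := fun s hs => (hfhat s hs).prod analyticAt_snd
  have hslice : ∀ s : Fin n → ℂ,
      Tendsto (fun x : Fin n → ℂ => (x, (0 : Fin r → ℂ))) (𝓝 s) (𝓝 (s, 0)) := fun s =>
    (by fun_prop : Continuous fun x : Fin n → ℂ => (x, (0 : Fin r → ℂ))).tendsto s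
  have hsub : ∀ (P : (Fin n → ℂ) × (Fin r → ℂ) → Prop),
      (∀ᶠ q in 𝓝ˢ (S ×ˢ ({0} : Set (Fin r → ℂ))), P q) ↔ ∀ s ∈ S, ∀ᶠ q in 𝓝 (s, 0), P q := by
    intro P
    rw [eventually_nhdsSet_iff_forall]
    constructor
    · exact fun h s hs => h (s, 0) ⟨hs, rfl⟩
    · rintro h ⟨s, t⟩ ⟨hs, rfl⟩
      exact h s hs
  simp only [hsub] at hstab ⊢
  simp only [eventually_nhdsSet_iff_forall]
  have hdF : ∀ s ∈ S, ∀ᶠ q in 𝓝 (s, (0 : Fin r → ℂ)), ∀ v,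
      fderiv ℂ F q v = (fderiv ℂ fhat q v, v.2) := by
    intro s hs
    filter_upwards [(hfhat s hs).eventually_analyticAt] with q hq v
    rw [(hq.differentiableAt.hasFDerivAt.prodMk hasFDerivAt_snd).fderiv]
    rfl
  have hdf : ∀ s ∈ S, ∀ᶠ x in 𝓝 s, ∀ v,
      fderiv ℂ f x v = fderiv ℂ fhat (x, 0) (v, 0) := by
    intro s hs
    filter_upwards [(hslice s).eventually (hfhat s hs).eventually_analyticAt] with x hx v
    obtain rfl : f = fun x => fhat (x, 0) := funext fun x => (hunf x).symm
    have h := HasFDerivAt.comp (𝕜 := ℂ) x hx.differentiableAt.hasFDerivAt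
      (hasFDerivAt_prodMk_left x (0 : Fin r → ℂ))
    rw [show (fun x => fhat (x, 0)) = fhat ∘ fun x => (x, 0) from rfl, h.fderiv]
    simp
  constructor
  · rintro ⟨ξ, hξ, hlift⟩
    have hξ' : ∀ s ∈ S, AnalyticAt ℂ
        (fun q : (Fin n → ℂ) × (Fin r → ℂ) => (ξ q.1, (0 : Fin r → ℂ))) (s, 0) := fun s hs =>
      (AnalyticAt.fun_comp (hξ s hs) analyticAt_fst).prod analyticAt_const
    let g : (Fin n → ℂ) × (Fin r → ℂ) → (Fin p → ℂ) × (Fin r → ℂ) := fun q =>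
      fderiv ℂ F q (ξ q.1, 0) - (ηbar (F q).1, 0)
    have hg : ∀ s ∈ S, AnalyticAt ℂ g (s, 0) := by
      intro s hs
      refine ((hFan s hs).fderiv.clm_apply_of_analyticAt (hξ' s hs)).sub ((AnalyticAt.fun_comp ?_
        (hfhat s hs)).prod analyticAt_const)
      simpa only [hunf, hf0 s hs] using hηbar
    have hg0 : ∀ s ∈ S, ∀ᶠ x in 𝓝 s, g (x, 0) = 0 := by
      intro s hs
      filter_upwards [hlift s hs, hdf s hs, (hslice s).eventually (hdF s hs)] with x h1 h2 h3
      have hFx : F (x, 0) = (f x, 0) := by simp only [hFdef, hunf]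
      simp only [g, h3, ← h2, h1, hFx, sub_self]
    let π : (Fin n → ℂ) × (Fin r → ℂ) →L[ℂ] (Fin n → ℂ) × (Fin r → ℂ) :=
      (ContinuousLinearMap.fst ℂ _ _).prod 0
    have hQ : ∀ s : (Fin n → ℂ) × (Fin r → ℂ), ∃ Q : (Fin n → ℂ) × (Fin r → ℂ) →
        ((Fin n → ℂ) × (Fin r → ℂ) →L[ℂ] (Fin p → ℂ) × (Fin r → ℂ)), AnalyticAt ℂ g s →
        AnalyticAt ℂ Q s ∧ ∀ᶠ z in 𝓝 s, g z - g (s + π (z - s)) = Q z (z - s - π (z - s)) := by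
      intro s
      by_cases h : AnalyticAt ℂ g s
      · obtain ⟨Q, hQ⟩ := h.exists_diffQuot π
        exact ⟨Q, fun _ => hQ⟩
      · exact ⟨0, fun h' => absurd h' h⟩
    choose Q hQ using hQ
    obtain ⟨R, hR⟩ := (hSfin.prod (Set.finite_singleton (0 : Fin r → ℂ))).exists_eventuallyEq Q
    have hRan : ∀ s ∈ S, AnalyticAt ℂ R (s, 0) := fun s hs =>
      (hQ (s, 0) (hg s hs)).1.congr (hR (s, 0) ⟨hs, rfl⟩).symm
    have hgR : ∀ s ∈ S, ∀ᶠ q in 𝓝 (s, (0 : Fin r → ℂ)), g q = R q (0, q.2) := by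
      intro s hs
      have h0 : ∀ᶠ q in 𝓝 (s, (0 : Fin r → ℂ)), g (q.1, 0) = 0 :=
        (continuous_fst.tendsto (s, (0 : Fin r → ℂ))).eventually (hg0 s hs)
      filter_upwards [(hQ (s, 0) (hg s hs)).2, hR (s, 0) ⟨hs, rfl⟩, h0] with q h1 h2 h3
      have e1 : (s, (0 : Fin r → ℂ)) + π (q - (s, 0)) = (q.1, 0) := by
        ext <;> simp [π]
      have e2 : q - (s, (0 : Fin r → ℂ)) - π (q - (s, 0)) = (0, q.2) := by
        ext <;> simp [π]
      rw [e1, e2, h3, sub_zero] at h1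
      rw [h1, h2]
    choose ζ θ hζ hθ hζθ using fun j : Fin r => hstab (fun q => R q (0, Pi.single j 1))
      (fun s hs => (hRan s hs).clm_apply_of_analyticAt analyticAt_const)
    have hcoord : ∀ (j : Fin r) {m : ℕ} (q : (Fin m → ℂ) × (Fin r → ℂ)),
        AnalyticAt ℂ (fun q : (Fin m → ℂ) × (Fin r → ℂ) => q.2 j) q := fun j m q =>
      ((ContinuousLinearMap.proj (R := ℂ) (φ := fun _ : Fin r => ℂ) j).comp
        (ContinuousLinearMap.snd ℂ (Fin m → ℂ) (Fin r → ℂ))).analyticAt q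
    refine ⟨fun q => (ηbar q.1, 0) + ∑ j, q.2 j • θ j q, ?_,
      ⟨fun q => (ξ q.1, 0) - ∑ j, q.2 j • ζ j q, ?_, ?_⟩, ?_, ?_⟩
    · exact ((AnalyticAt.fun_comp (f := Prod.fst) (x := 0) hηbar analyticAt_fst).prod analyticAt_const).add
        (Finset.analyticAt_fun_sum _ fun j _ => (hcoord j _).smul (hθ j))
    · exact fun s hs => (hξ' s hs).sub
        (Finset.analyticAt_fun_sum _ fun j _ => (hcoord j _).smul (hζ j s hs))
    · intro s hs
      filter_upwards [hgR s hs, eventually_all.2 fun j => hζθ j s hs] with q h1 h2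
      have hsum : R q (0, q.2) = ∑ j, q.2 j • (fderiv ℂ F q (ζ j q) + θ j (F q)) := by
        simp only [← h2, ← map_smul, ← map_sum]
        congr 1
        ext i
        · simp [Prod.fst_sum]
        · simp [Prod.snd_sum, Finset.sum_apply, Pi.single_apply]
      rw [hsum] at h1
      simp only [smul_add, Finset.sum_add_distrib] at h1
      rw [map_sub, map_sum]
      simp only [map_smul]
      rw [sub_eq_iff_eq_add.1 h1]
      change _ = _ + ∑ j, q.2 j • θ j (F q)
      abel
    · simp
    · simp
  · rintro ⟨η, -, ⟨ξ, hξ, hlift⟩, hη2, hη1⟩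
    refine ⟨fun x => (ξ (x, 0)).1, fun s hs => ?_, fun s hs => ?_⟩
    · exact analyticAt_fst.fun_comp (AnalyticAt.fun_comp (hξ s hs) (analyticAt_id.prod analyticAt_const))
    · have hf_lim : Tendsto f (𝓝 s) (𝓝 0) := by
        simpa [hf0 s hs] using (hf s hs).continuousAt.tendsto
      filter_upwards [(hslice s).eventually (hlift s hs), (hslice s).eventually (hdF s hs),
        hdf s hs, hf_lim.eventually hη1, hf_lim.eventually hη2] with x h1 h2 h3 h4 h5
      rw [h2] at h1
      simp only [hFdef, hunf] at h1
      rw [h3, h4, ← h1]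
      rw [← h1] at h5
      congr 1
      exact Prod.ext rfl h5.symm
end

section
/- Let S ⊂ ℂⁿ be a finite set, let f be a holomorphic map defined on a neighbourhood of S with f(S) = {0} (a multigerm f : (ℂⁿ,S) → (ℂᵖ,0)), and let F(x,λ) = (f_λ(x), λ) be any r-parameter unfolding of f (no stability assumption). If η = (η₁,…,η_{p+r}) : (ℂ^{p+r},0) → ℂ^{p+r} is a holomorphic vector-field germ liftable over F such that η_{p+j}(X,0) = 0 for all j = 1,…,r and all X near 0 ∈ ℂᵖ, then the vector-field germ X ↦ (η₁(X,0),…,η_p(X,0)) on (ℂᵖ,0) is liftable over f. -/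
open Filter Topology

/-- If `F(x,λ) = (f_λ(x),λ)` is any `r`-parameter unfolding of the multigerm
`f : (ℂⁿ,S) → (ℂᵖ,0)` and `η` is liftable over `F` with its last `r` components vanishing on
`{Λ = 0}`, then `X ↦ (η₁(X,0),…,η_p(X,0))` is liftable over `f`. -/
theorem liftable_of_liftable_unfolding
    (n p r : ℕ) (S : Set (Fin n → ℂ)) (hSfin : S.Finite)
    (f : (Fin n → ℂ) → (Fin p → ℂ))
    (hf : ∀ s ∈ S, AnalyticAt ℂ f s) (hf0 : ∀ s ∈ S, f s = 0)
    (fhat : (Fin n → ℂ) × (Fin r → ℂ) → (Fin p → ℂ))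
    (hfhat : ∀ s ∈ S, AnalyticAt ℂ fhat (s, 0))
    (hunf : ∀ x : Fin n → ℂ, fhat (x, 0) = f x)
    (F : (Fin n → ℂ) × (Fin r → ℂ) → (Fin p → ℂ) × (Fin r → ℂ))
    (hF : ∀ q, F q = (fhat q, q.2))
    (η : (Fin p → ℂ) × (Fin r → ℂ) → (Fin p → ℂ) × (Fin r → ℂ))
    (hη : AnalyticAt ℂ η 0)
    -- `η` is liftable over `F`:
    (hlift : ∃ ξ : (Fin n → ℂ) × (Fin r → ℂ) → (Fin n → ℂ) × (Fin r → ℂ),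
      (∀ s ∈ S, AnalyticAt ℂ ξ (s, 0)) ∧
      ∀ᶠ q in 𝓝ˢ (S ×ˢ ({0} : Set (Fin r → ℂ))),
        fderiv ℂ F q (ξ q) = η (F q))
    -- the last `r` components of `η` vanish on `{Λ = 0}`:
    (hzero : ∀ᶠ X in 𝓝 (0 : Fin p → ℂ), (η (X, 0)).2 = 0) :
    -- then `X ↦ (η₁(X,0),…,η_p(X,0))` is liftable over `f`:
    ∃ ξ : (Fin n → ℂ) → (Fin n → ℂ), (∀ s ∈ S, AnalyticAt ℂ ξ s) ∧
      ∀ᶠ x in 𝓝ˢ S, fderiv ℂ f x (ξ x) = (η (f x, 0)).1 := by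
  obtain ⟨ξ, hξ, hξF⟩ := hlift
  obtain rfl : F = fun q => (fhat q, q.2) := funext hF
  obtain rfl : (fun x => fhat (x, 0)) = f := funext hunf
  rw [eventually_nhdsSet_iff_forall] at hξF
  refine ⟨fun x => (ξ (x, 0)).1, fun s hs => ?_, ?_⟩
  · exact analyticAt_fst.comp
      ((hξ s hs).comp₂ analyticAt_id analyticAt_const)
  rw [eventually_nhdsSet_iff_forall]
  intro s hs
  have hι : Tendsto (fun x : Fin n → ℂ => (x, (0 : Fin r → ℂ))) (𝓝 s) (𝓝 (s, 0)) :=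
    (Continuous.prodMk_left (0 : Fin r → ℂ)).tendsto s
  have hfs : Tendsto (fun x => fhat (x, 0)) (𝓝 s) (𝓝 0) := by
    simpa only [hf0 s hs] using (hf s hs).continuousAt.tendsto
  filter_upwards [hι.eventually (hξF (s, 0) ⟨hs, rfl⟩),
    hι.eventually (hfhat s hs).eventually_analyticAt, hfs.eventually hzero] with x hx hfx hx0
  have hd := hfx.differentiableAt.hasFDerivAt
  rw [(hd.prodMk hasFDerivAt_snd).fderiv] at hx
  have hv : (ξ (x, 0)).2 = 0 := (congrArg Prod.snd hx).trans hx0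
  have hx1 : fderiv ℂ fhat (x, 0) (ξ (x, 0)) = (η (fhat (x, 0), 0)).1 := congrArg Prod.fst hx
  have hc : HasFDerivAt (fun y => fhat (y, 0))
      ((fderiv ℂ fhat (x, 0)).comp (.inl ℂ (Fin n → ℂ) (Fin r → ℂ))) x :=
    HasFDerivAt.comp x hd (hasFDerivAt_prodMk_left x 0)
  rw [hc.fderiv, ← hx1]
  have hξx : ((ξ (x, 0)).1, (0 : Fin r → ℂ)) = ξ (x, 0) := Prod.ext rfl hv.symm
  exact congrArg (fderiv ℂ fhat (x, 0)) hξx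
end

section
/- Fix an integer k ≥ 2. Let F : ℂ⁴ → ℂ⁵ be F(u₁,v₁,v₂,y) = (u₁, v₁, v₂, y³+u₁y, v₁y+v₂y²) and let G_k : ℂ⁵ → ℂ⁵ be G_k(U₁,V₁,V₂,W₁,W₂) = (U₁, V₁, V₂−W₁^{k−1}, W₁, W₂). Then there exist a holomorphic germ ψ : (ℂ²,0) → ℂ with ψ(0,y) = 0 for all y near 0, and a biholomorphic germ σ : (ℂ⁴,0) → (ℂ⁴,0), such that G_k ∘ F ∘ σ = F_k as germs at 0, where F_k(u₁,v₁,v₂,y) = (u₁, v₁, v₂, y³+u₁y, v₁y+v₂y²+ψ(u₁,y)y²+y^{3k−1}). In particular F is 𝒜-equivalent to F_k. -/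
open Filter Topology

/-- A product of two differentiable functions vanishing at a point has zero derivative there. -/
theorem hasFDerivAt_mul_zero_of_eq_zero {E : Type*} [NormedAddCommGroup E] [NormedSpace ℂ E]
    {f g : E → ℂ} {x : E} (hf : DifferentiableAt ℂ f x) (hg : DifferentiableAt ℂ g x)
    (hfx : f x = 0) (hgx : g x = 0) : HasFDerivAt (fun v => f v * g v) (0 : E →L[ℂ] ℂ) x := by
  have h := hf.hasFDerivAt.fun_mul hg.hasFDerivAt
  refine h.congr_fderiv ?_
  ext
  simp [hfx, hgx]

/-- For `k ≥ 2`, the stable map `F(u₁,v₁,v₂,y) = (u₁,v₁,v₂,y³+u₁y,v₁y+v₂y²)`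
satisfies `G_k ∘ F ∘ σ = F_k` as germs at `0` for a suitable biholomorphic germ `σ` of
`(ℂ⁴,0)` and a holomorphic germ `ψ` with `ψ(0,y) = 0`, where
`G_k(U₁,V₁,V₂,W₁,W₂) = (U₁,V₁,V₂−W₁^{k−1},W₁,W₂)` and
`F_k(u₁,v₁,v₂,y) = (u₁,v₁,v₂,y³+u₁y,v₁y+v₂y²+ψ(u₁,y)y²+y^{3k−1})`.
In particular `F` is 𝒜-equivalent to `F_k`. -/
theorem F_A_equivalent_to_Fk
    (k : ℕ) (hk : 2 ≤ k)
    (F : (Fin 4 → ℂ) → (Fin 5 → ℂ))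
    (hF : ∀ v : Fin 4 → ℂ,
      F v = ![v 0, v 1, v 2, (v 3) ^ 3 + v 0 * v 3, v 1 * v 3 + v 2 * (v 3) ^ 2])
    (Gk : (Fin 5 → ℂ) → (Fin 5 → ℂ))
    (hGk : ∀ V : Fin 5 → ℂ, Gk V = ![V 0, V 1, V 2 - (V 3) ^ (k - 1), V 3, V 4]) :
    ∃ (ψ : ℂ × ℂ → ℂ) (σ : (Fin 4 → ℂ) → (Fin 4 → ℂ)),
      AnalyticAt ℂ ψ 0 ∧ (∀ᶠ y in 𝓝 (0 : ℂ), ψ (0, y) = 0) ∧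
      -- σ is a biholomorphic germ of (ℂ⁴,0):
      AnalyticAt ℂ σ 0 ∧ σ 0 = 0 ∧
      (∃ e : (Fin 4 → ℂ) ≃L[ℂ] (Fin 4 → ℂ),
        (e : (Fin 4 → ℂ) →L[ℂ] (Fin 4 → ℂ)) = fderiv ℂ σ 0) ∧
      -- G_k ∘ F ∘ σ = F_k as germs at 0:
      ∀ᶠ v in 𝓝 (0 : Fin 4 → ℂ),
        Gk (F (σ v)) =
          ![v 0, v 1, v 2, (v 3) ^ 3 + v 0 * v 3,
            v 1 * v 3 + v 2 * (v 3) ^ 2 + ψ (v 0, v 3) * (v 3) ^ 2 + (v 3) ^ (3 * k - 1)] := by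
  obtain ⟨m, rfl⟩ := Nat.exists_eq_add_of_le' hk
  have h_sub : m + 2 - 1 = m + 1 := rfl
  have h_exp : 3 * (m + 2) - 1 = 3 * (m + 1) + 2 := by omega
  set p : (Fin 4 → ℂ) → ℂ := fun v => (v 3 ^ 3 + v 0 * v 3) ^ (m + 1) with hp
  have hcoord (i : Fin 4) : AnalyticAt ℂ (fun v : Fin 4 → ℂ => v i) 0 :=
    (ContinuousLinearMap.proj (R := ℂ) (φ := fun _ : Fin 4 => ℂ) i).analyticAt 0
  have hp_an : AnalyticAt ℂ p 0 :=
    (((hcoord 3).pow 3).add ((hcoord 0).mul (hcoord 3))).pow (m + 1)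
  have hp_deriv : HasFDerivAt p (0 : (Fin 4 → ℂ) →L[ℂ] ℂ) 0 := by
    have h := hasFDerivAt_mul_zero_of_eq_zero (x := (0 : Fin 4 → ℂ))
      (f := fun v => v 3)
      (g := fun v => (v 3 ^ 3 + v 0 * v 3) ^ m * (v 3 ^ 2 + v 0))
      (by fun_prop) (by fun_prop) (by simp) (by simp)
    refine h.congr_of_eventuallyEq (.of_forall fun v => ?_)
    simp only [hp]
    ring
  have hσ_deriv : HasFDerivAt (fun v : Fin 4 → ℂ => v + p v • Pi.single (2 : Fin 4) (1 : ℂ))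
      (ContinuousLinearMap.id ℂ (Fin 4 → ℂ)) 0 := by
    have h := (hasFDerivAt_id (𝕜 := ℂ) (0 : Fin 4 → ℂ)).add
      (hp_deriv.smul_const (Pi.single (2 : Fin 4) (1 : ℂ) : Fin 4 → ℂ))
    refine h.congr_fderiv ?_
    ext
    simp
  refine ⟨fun z => (z.2 ^ 3 + z.1 * z.2) ^ (m + 1) - z.2 ^ (3 * (m + 1)),
    fun v => v + p v • Pi.single (2 : Fin 4) (1 : ℂ), ?_, .of_forall fun y => ?_,
    analyticAt_id.add (hp_an.smul analyticAt_const), ?_,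
    ⟨.refl ℂ _,
      (ContinuousLinearEquiv.coe_refl (R₁ := ℂ) (M₁ := Fin 4 → ℂ)).trans hσ_deriv.fderiv.symm⟩,
    .of_forall fun v => ?_⟩
  · exact (((analyticAt_snd.pow 3).add (analyticAt_fst.mul analyticAt_snd)).pow (m + 1)).sub
      (analyticAt_snd.pow (3 * (m + 1)))
  · simp [pow_mul]
  · simp [hp]
  · rw [hF, hGk, h_sub, h_exp]
    ext i
    fin_cases i <;> simp [hp]
    ring
end

section
/- Let F : ℂ⁴ → ℂ⁵ be F(u₁,v₁,v₂,y) = (u₁, v₁, v₂, y³+u₁y, v₁y+v₂y²). Each of the following seven polynomial vector fields on ℂ⁵ (in coordinates (U₁,V₁,V₂,W₁,W₂)) is liftable over F: η_e = (2U₁, 2V₁, V₂, 3W₁, 3W₂); η₁¹ = (4U₁², −3U₁V₁+3V₂W₁, −5U₁V₂−3W₂, 6U₁W₁, −3V₁W₁+2U₁W₂); η₁² = (6U₁, −3V₁, −6V₂, 9W₁, 0); η₁³ = (9V₁, −6V₂², 0, 9W₂+3U₁V₂, 3V₁V₂); η₂¹ = (0, −3U₁V₂−3W₂, 3V₁, 0,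 −3V₂W₁); η₂² = (−9W₁, 2U₁V₂, −3V₁, 2U₁², 6V₂W₁+2U₁V₁); η₂³ = (−9W₂−3U₁V₂, −3V₁V₂, 0, 3U₁V₁, 6V₂W₂+3V₁²). -/
open Filter Topology

/-- A vector-field germ `η` on `(ℂᵖ,0)` is liftable over the map-germ
`F : (ℂⁿ,0) → (ℂᵖ,0)` if there is a holomorphic germ `ξ` on `(ℂⁿ,0)` with
`dF(x)(ξ(x)) = η(F(x))` near `0`. -/
def Liftable {n p : ℕ} (F : (Fin n → ℂ) → (Fin p → ℂ))
    (η : (Fin p → ℂ) → (Fin p → ℂ)) : Prop :=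
  ∃ ξ : (Fin n → ℂ) → (Fin n → ℂ), AnalyticAt ℂ ξ 0 ∧
    ∀ᶠ x in 𝓝 (0 : Fin n → ℂ), fderiv ℂ F x (ξ x) = η (F x)

theorem hasFDerivAt_map_of_coordinates (x : Fin 4 → ℂ) :
    HasFDerivAt (fun v : Fin 4 → ℂ =>
        ![v 0, v 1, v 2, (v 3) ^ 3 + v 0 * v 3, v 1 * v 3 + v 2 * (v 3) ^ 2])
      (ContinuousLinearMap.pi
        (let e : Fin 4 → ((Fin 4 → ℂ) →L[ℂ] ℂ) := fun i => ContinuousLinearMap.proj i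
        ![e 0, e 1, e 2, (3 * x 3 ^ 2 + x 0) • e 3 + x 3 • e 0,
          (x 1 + 2 * x 2 * x 3) • e 3 + x 3 • e 1 + x 3 ^ 2 • e 2])) x := by
  have h (i : Fin 4) : HasFDerivAt (fun v : Fin 4 → ℂ => v i)
      (ContinuousLinearMap.proj i : (Fin 4 → ℂ) →L[ℂ] ℂ) x := hasFDerivAt_apply i x
  rw [hasFDerivAt_pi']
  intro i
  fin_cases i
  · exact h 0
  · exact h 1
  · exact h 2
  · refine (((h 3).pow 3).add ((h 0).mul (h 3))).congr_fderiv ?_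
    ext w
    simp
    ring
  · refine (((h 1).mul (h 3)).add ((h 2).mul ((h 3).pow 2))).congr_fderiv ?_
    ext w
    simp
    ring

/-- A vector field lifts as soon as its first three components, pulled back by `F`, together with
a suitable analytic `y`-component `b`, solve the last two equations. -/
theorem liftable_of_last_component
    (F : (Fin 4 → ℂ) → (Fin 5 → ℂ))
    (hF : ∀ v : Fin 4 → ℂ,
      F v = ![v 0, v 1, v 2, (v 3) ^ 3 + v 0 * v 3, v 1 * v 3 + v 2 * (v 3) ^ 2])
    (η : (Fin 5 → ℂ) → (Fin 5 → ℂ)) (b : (Fin 4 → ℂ) → ℂ)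
    (hη : ∀ i, AnalyticAt ℂ (fun x => η (F x) i) 0) (hb : AnalyticAt ℂ b 0)
    (h₁ : ∀ x, (3 * x 3 ^ 2 + x 0) * b x + x 3 * η (F x) 0 = η (F x) 3)
    (h₂ : ∀ x, (x 1 + 2 * x 2 * x 3) * b x + x 3 * η (F x) 1 + x 3 ^ 2 * η (F x) 2
      = η (F x) 4) :
    Liftable F η := by
  refine ⟨fun x => ![η (F x) 0, η (F x) 1, η (F x) 2, b x], ?_, .of_forall fun x => ?_⟩
  · refine AnalyticAt.pi fun i => ?_
    fin_cases i
    · exact hη 0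
    · exact hη 1
    · exact hη 2
    · exact hb
  · have hFx := hasFDerivAt_map_of_coordinates x
    rw [← funext hF] at hFx
    rw [hFx.fderiv]
    ext i
    fin_cases i
    · simp
    · simp
    · simp
    · simpa using h₁ x
    · simpa using h₂ x

/-- the seven listed polynomial vector fields on `ℂ⁵` are liftable over
`F(u₁,v₁,v₂,y) = (u₁,v₁,v₂,y³+u₁y,v₁y+v₂y²)`. -/
theorem liftable_fields_of_F
    (F : (Fin 4 → ℂ) → (Fin 5 → ℂ))
    (hF : ∀ v : Fin 4 → ℂ,
      F v = ![v 0, v 1, v 2, (v 3) ^ 3 + v 0 * v 3, v 1 * v 3 + v 2 * (v 3) ^ 2]) :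
    Liftable F (fun V => ![2 * V 0, 2 * V 1, V 2, 3 * V 3, 3 * V 4]) ∧
    Liftable F (fun V => ![4 * (V 0) ^ 2, -3 * V 0 * V 1 + 3 * V 2 * V 3,
      -5 * V 0 * V 2 - 3 * V 4, 6 * V 0 * V 3, -3 * V 1 * V 3 + 2 * V 0 * V 4]) ∧
    Liftable F (fun V => ![6 * V 0, -3 * V 1, -6 * V 2, 9 * V 3, 0]) ∧
    Liftable F (fun V => ![9 * V 1, -6 * (V 2) ^ 2, 0, 9 * V 4 + 3 * V 0 * V 2,
      3 * V 1 * V 2]) ∧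
    Liftable F (fun V => ![0, -3 * V 0 * V 2 - 3 * V 4, 3 * V 1, 0, -3 * V 2 * V 3]) ∧
    Liftable F (fun V => ![-9 * V 3, 2 * V 0 * V 2, -3 * V 1, 2 * (V 0) ^ 2,
      6 * V 2 * V 3 + 2 * V 0 * V 1]) ∧
    Liftable F (fun V => ![-9 * V 4 - 3 * V 0 * V 2, -3 * V 1 * V 2, 0, 3 * V 0 * V 1,
      6 * V 2 * V 4 + 3 * (V 1) ^ 2]) := by
  refine ⟨liftable_of_last_component F hF _ (fun x => x 3) ?_ ?_ ?_ ?_,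
    liftable_of_last_component F hF _ (fun x => 2 * x 0 * x 3) ?_ ?_ ?_ ?_,
    liftable_of_last_component F hF _ (fun x => 3 * x 3) ?_ ?_ ?_ ?_,
    liftable_of_last_component F hF _ (fun x => 3 * x 2) ?_ ?_ ?_ ?_,
    liftable_of_last_component F hF _ (fun _ => 0) ?_ ?_ ?_ ?_,
    liftable_of_last_component F hF _ (fun x => 3 * x 3 ^ 2 + 2 * x 0) ?_ ?_ ?_ ?_,
    liftable_of_last_component F hF _ (fun x => 3 * x 1 + 3 * x 2 * x 3) ?_ ?_ ?_ ?_⟩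
  all_goals first
    | (apply ContDiffAt.analyticAt; fun_prop)
    | (intro i; apply ContDiffAt.analyticAt; fin_cases i <;> simp [hF] <;> fun_prop)
    | (intro x; simp [hF]; done)
    | (intro x; simp [hF]; ring1)
end

section
/- Let H : (ℂᵖ×ℂ,0) → ℂ be holomorphic and let φ : (ℂ,0) → (ℂ,0) be a holomorphic germ with φ(0) = 0 and φ not identically zero; set h(X,Z) = H(X,φ(Z)). Suppose η = (η₁,…,η_{p+1}) and α are holomorphic germs at 0 with ∑_{i=1}^{p} η_i ∂H/∂X_i + η_{p+1} ∂H/∂Λ = α H near 0, and suppose moreover that η_{p+1}(X,0) = 0 for all X near 0 ∈ ℂᵖ. Define η̃_i(X,Z) = η_i(X,φ(Z)) φ′(Z) for 1 ≤ i ≤ p and η̃_{p+1}(X,Z) = η_{p+1}(X,φ(Z)). Then there exists a holomorphic germ ζ = (ζ₁,…,ζ_{p+1}) : (ℂ^{p+1},0) → ℂ^{p+1} such that φ′(Z) ζ(X,Z) = η̃(X,Z) near 0 and ∑_{i=1}^{p} ζ_i(X,Z) ∂h/∂X_i(X,Z) + ζ_{p+1}(X,Z) ∂h/∂Z(X,Z)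 = α(X,φ(Z)) h(X,Z) for all (X,Z) near 0. -/
open Filter Topology

open MeasureTheory in
/-- Averaging an analytic function along a continuous path of linear contractions
gives an analytic function. -/
lemma AnalyticAt.setIntegral_comp_clm {E F : Type*} [NormedAddCommGroup E] [NormedSpace ℂ E]
    [NormedAddCommGroup F] [NormedSpace ℂ F] [CompleteSpace F] {f : E → F}
    (hf : AnalyticAt ℂ f 0) {L : ℝ → E →L[ℂ] E} (hL : Continuous L)
    (hL1 : ∀ t ∈ Set.Ioc (0 : ℝ) 1, ‖L t‖ ≤ 1) :
    AnalyticAt ℂ (fun y => ∫ t in Set.Ioc (0 : ℝ) 1, f (L t y)) 0 := by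
  obtain ⟨P, r, hP⟩ := hf
  have hcont : ∀ n, Continuous fun t => (P n).compContinuousLinearMap fun _ => L t := fun n =>
    (ContinuousMultilinearMap.compContinuousLinearMapContinuousMultilinear ℂ
      (fun _ : Fin n => E) (fun _ : Fin n => E) F).cont.comp
      (continuous_pi fun _ => hL) |>.clm_apply continuous_const
  have hint : ∀ n, Integrable (fun t => (P n).compContinuousLinearMap fun _ => L t)
      (volume.restrict (Set.Ioc (0 : ℝ) 1)) := fun n =>
    ((hcont n).integrableOn_Icc (a := 0) (b := 1)).mono_set Set.Ioc_subset_Icc_self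
  let Q : FormalMultilinearSeries ℂ E F := fun n =>
    ∫ t in Set.Ioc (0 : ℝ) 1, (P n).compContinuousLinearMap fun _ => L t
  have hnorm : ∀ n, ‖Q n‖ ≤ ‖P n‖ := fun n => by
    have hle : ∀ t ∈ Set.Ioc (0 : ℝ) 1,
        ‖(P n).compContinuousLinearMap fun _ => L t‖ ≤ ‖P n‖ := fun t ht =>
      (ContinuousMultilinearMap.norm_compContinuousLinearMap_le _ _).trans <|
        mul_le_of_le_one_right (norm_nonneg _) <|
          Finset.prod_le_one (fun _ _ => norm_nonneg _) fun _ _ => hL1 t ht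
    simpa using norm_setIntegral_le_of_norm_le_const (μ := volume) (by simp) hle
  refine ⟨Q, r, hP.r_le.trans ?_, hP.r_pos, fun {y} hy => ?_⟩
  · refine ENNReal.le_of_forall_nnreal_lt fun s hs => ?_
    obtain ⟨C, -, hC⟩ := P.norm_mul_pow_le_of_lt_radius hs
    exact Q.le_radius_of_bound C fun n =>
      (mul_le_mul_of_nonneg_right (hnorm n) (by positivity)).trans (hC n)
  · have hLy : ∀ t ∈ Set.Ioc (0 : ℝ) 1, ‖L t y‖ ≤ ‖y‖ := fun t ht =>
      (L t).le_of_opNorm_le_of_le (hL1 t ht) le_rfl |>.trans_eq (one_mul _)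
    have hQ : ∀ n, (Q n fun _ => y) = ∫ t in Set.Ioc (0 : ℝ) 1, P n fun _ => L t y := fun n => by
      simp only [Q]
      rw [ContinuousMultilinearMap.integral_apply (hint n)]
      rfl
    simp only [hQ, zero_add]
    have hyr : (‖y‖₊ : ENNReal) < P.radius := by
      have := Metric.mem_eball.1 hy
      rw [edist_zero_right] at this
      exact this.trans_le hP.r_le
    refine hasSum_integral_of_dominated_convergence (fun n _ => ‖P n‖ * ‖y‖ ^ n)
      (fun n => ?_) (fun n => ?_) ?_ ?_ ?_
    · have : Continuous fun t => L t y := hL.clm_apply continuous_const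
      exact ((P n).cont.comp (continuous_pi fun _ => this)).aestronglyMeasurable
    · filter_upwards [ae_restrict_mem measurableSet_Ioc] with t ht
      refine ((P n).le_opNorm _).trans ?_
      simp only [Finset.prod_const, Finset.card_univ, Fintype.card_fin]
      gcongr
      exact hLy t ht
    · exact .of_forall fun _ => by simpa using P.summable_norm_mul_pow hyr
    · exact integrable_const _
    · filter_upwards [ae_restrict_mem measurableSet_Ioc] with t ht
      have hmem : L t y ∈ Metric.eball (0 : E) r := by
        rw [Metric.mem_eball, edist_zero_right] at hy ⊢
        exact (enorm_le_iff_norm_le.2 (hLy t ht)).trans_lt hy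
      simpa using hP.hasSum hmem

open MeasureTheory in
/-- Hadamard's lemma for holomorphic germs: `g(x,z) - g(x,0)` is divisible by `z`. -/
lemma AnalyticAt.exists_sub_eq_snd_smul {E F : Type*} [NormedAddCommGroup E] [NormedSpace ℂ E]
    [NormedAddCommGroup F] [NormedSpace ℂ F] [CompleteSpace F] {g : E × ℂ → F}
    (hg : AnalyticAt ℂ g 0) :
    ∃ k : E × ℂ → F, AnalyticAt ℂ k 0 ∧
      ∀ᶠ q in 𝓝 (0 : E × ℂ), g q - g (q.1, 0) = q.2 • k q := by
  let L : ℝ → E × ℂ →L[ℂ] E × ℂ := fun t =>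
    (ContinuousLinearMap.inl ℂ E ℂ).comp (ContinuousLinearMap.fst ℂ E ℂ) +
      (t : ℂ) • (ContinuousLinearMap.inr ℂ E ℂ).comp (ContinuousLinearMap.snd ℂ E ℂ)
  have hLapp : ∀ t q, L t q = (q.1, (t : ℂ) * q.2) := fun t q => by simp [L]
  have hL : Continuous L := by fun_prop
  have hLle : ∀ t ∈ Set.Icc (0 : ℝ) 1, ∀ q, ‖L t q‖ ≤ ‖q‖ := fun t ht q => by
    rw [hLapp]
    refine max_le (norm_fst_le q) ?_
    rw [norm_mul, Complex.norm_real, Real.norm_of_nonneg ht.1]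
    exact (mul_le_of_le_one_left (norm_nonneg _) ht.2).trans (norm_snd_le q)
  have hd : AnalyticAt ℂ (fun q => fderiv ℂ g q (0, 1)) 0 :=
    ((ContinuousLinearMap.apply ℂ F ((0 : E), (1 : ℂ))).analyticAt _).comp hg.fderiv
  refine ⟨_, hd.setIntegral_comp_clm hL fun t ht =>
    (L t).opNorm_le_bound zero_le_one fun q => by
      simpa using hLle t (Set.Ioc_subset_Icc_self ht) q, ?_⟩
  obtain ⟨ε, hε, hball⟩ := Metric.eventually_nhds_iff_ball.1 hg.eventually_analyticAt
  filter_upwards [Metric.ball_mem_nhds _ hε] with q hq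
  have han : ∀ t ∈ Set.Icc (0 : ℝ) 1, AnalyticAt ℂ g (L t q) := fun t ht =>
    hball _ (mem_ball_zero_iff.2 ((hLle t ht q).trans_lt (mem_ball_zero_iff.1 hq)))
  have hLq : Continuous fun t => L t q := hL.clm_apply continuous_const
  have hderiv : ∀ t ∈ Set.uIcc (0 : ℝ) 1,
      HasDerivAt (fun t => g (L t q)) (q.2 • fderiv ℂ g (L t q) (0, 1)) t := fun t ht => by
    rw [Set.uIcc_of_le zero_le_one] at ht
    have hpath : HasDerivAt (fun t : ℝ => L t q) (0, q.2) t := by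
      simp only [hLapp]
      exact (hasDerivAt_const t q.1).prodMk
        (by simpa using (Complex.ofRealCLM.hasDerivAt (x := t)).mul_const q.2)
    have := ((han t ht).differentiableAt.hasFDerivAt.restrictScalars ℝ).comp_hasDerivAt t hpath
    convert! this using 1
    simp [← map_smul]
  have hcont : ContinuousOn (fun t => q.2 • fderiv ℂ g (L t q) (0, 1)) (Set.uIcc (0 : ℝ) 1) :=
    fun t ht => by
      rw [Set.uIcc_of_le zero_le_one] at ht
      have h₁ : ContinuousAt (fun t => fderiv ℂ g (L t q)) t :=
        (han t ht).fderiv.continuousAt.comp (f := fun t => L t q) hLq.continuousAt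
      exact ((h₁.clm_apply continuousAt_const).const_smul q.2).continuousWithinAt
  have hftc := intervalIntegral.integral_eq_sub_of_hasDerivAt hderiv hcont.intervalIntegrable
  rw [intervalIntegral.integral_of_le zero_le_one, integral_smul] at hftc
  rw [hftc]
  simp [hLapp]

/-- For a nonzero holomorphic germ `f` vanishing at `0`, the quotient of `f` by its derivative is
holomorphic. -/
lemma AnalyticAt.exists_deriv_mul_eq {f : ℂ → ℂ} (hf : AnalyticAt ℂ f 0) (hf0 : f 0 = 0)
    (hfne : ¬ ∀ᶠ z in 𝓝 (0 : ℂ), f z = 0) :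
    ∃ ψ : ℂ → ℂ, AnalyticAt ℂ ψ 0 ∧ ∀ᶠ z in 𝓝 (0 : ℂ), deriv f z * ψ z = f z := by
  obtain ⟨n, u, hu, hu0, hfu⟩ := hf.exists_eventuallyEq_pow_smul_nonzero_iff.2 hfne
  simp only [sub_zero, smul_eq_mul] at hfu
  obtain _ | n := n
  · exact absurd (by simpa [hf0] using hfu.self_of_nhds.symm) hu0
  have hden : AnalyticAt ℂ (fun z => (n + 1) * u z + z * deriv u z) 0 :=
    (analyticAt_const.mul hu).add (analyticAt_id.mul hu.deriv)
  have hden0 : ((n : ℂ) + 1) * u 0 + 0 * deriv u 0 ≠ 0 := by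
    simpa [hu0] using n.cast_add_one_ne_zero (R := ℂ)
  refine ⟨fun z => z * u z / ((n + 1) * u z + z * deriv u z),
    (analyticAt_id.mul hu).div hden hden0, ?_⟩
  filter_upwards [hfu.eventually_nhds, hu.eventually_analyticAt,
    hden.continuousAt.eventually_ne hden0] with z hz huz hdz
  have hd : deriv f z = z ^ n * ((n + 1) * u z + z * deriv u z) := by
    rw [EventuallyEq.deriv_eq hz]
    refine ((hasDerivAt_pow (n + 1) z).mul huz.differentiableAt.hasDerivAt).deriv.trans ?_
    push_cast
    ring
  rw [hd, hz.self_of_nhds]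
  field_simp
  ring

/-- if `η(H) = αH` near `0`, `η_{p+1}(X,0) = 0` and `φ : (ℂ,0) → (ℂ,0)` is a
nonzero germ, then the pulled-back field `η̃` (with `η̃_i = (η_i ∘ (id,φ))·φ′` for `i ≤ p`,
`η̃_{p+1} = η_{p+1} ∘ (id,φ)`) is divisible by `φ′`: there is a holomorphic germ `ζ` with
`φ′·ζ = η̃` near `0` and `ζ(h) = (α∘(id,φ))·h` near `0`, where `h(X,Z) = H(X,φ(Z))`. -/
theorem pullback_derlog_divisible
    (p : ℕ)
    (H : (Fin p → ℂ) × ℂ → ℂ) (hH : AnalyticAt ℂ H 0)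
    (φ : ℂ → ℂ) (hφ : AnalyticAt ℂ φ 0) (hφ0 : φ 0 = 0)
    (hφne : ¬ ∀ᶠ z in 𝓝 (0 : ℂ), φ z = 0)
    (η : (Fin p → ℂ) × ℂ → (Fin p → ℂ) × ℂ) (hη : AnalyticAt ℂ η 0)
    (α : (Fin p → ℂ) × ℂ → ℂ) (hα : AnalyticAt ℂ α 0)
    -- η(H) = α·H near 0:
    (hrel : ∀ᶠ q in 𝓝 (0 : (Fin p → ℂ) × ℂ),
      (∑ i : Fin p, (η q).1 i * fderiv ℂ H q (Pi.single i 1, 0))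
        + (η q).2 * fderiv ℂ H q (0, 1) = α q * H q)
    -- η_{p+1}(X,0) = 0 for X near 0:
    (hlast : ∀ᶠ X in 𝓝 (0 : Fin p → ℂ), (η (X, 0)).2 = 0)
    (h : (Fin p → ℂ) × ℂ → ℂ)
    (hh : ∀ q : (Fin p → ℂ) × ℂ, h q = H (q.1, φ q.2)) :
    ∃ ζ : (Fin p → ℂ) × ℂ → (Fin p → ℂ) × ℂ,
      AnalyticAt ℂ ζ 0 ∧
      -- φ′·ζ = η̃ near 0:
      (∀ᶠ q in 𝓝 (0 : (Fin p → ℂ) × ℂ),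
        deriv φ q.2 • ζ q =
          ((fun i => (η (q.1, φ q.2)).1 i * deriv φ q.2), (η (q.1, φ q.2)).2)) ∧
      -- ζ(h) = (α∘(id,φ))·h near 0:
      (∀ᶠ q in 𝓝 (0 : (Fin p → ℂ) × ℂ),
        (∑ i : Fin p, (ζ q).1 i * fderiv ℂ h q (Pi.single i 1, 0))
          + (ζ q).2 * fderiv ℂ h q (0, 1) = α (q.1, φ q.2) * h q) := by
  have hΦ : AnalyticAt ℂ (fun q : (Fin p → ℂ) × ℂ => (q.1, φ q.2)) 0 :=
    analyticAt_fst.prod (AnalyticAt.comp (g := φ) (f := Prod.snd) hφ analyticAt_snd)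
  have hΦ0 : ((0 : (Fin p → ℂ) × ℂ).1, φ (0 : (Fin p → ℂ) × ℂ).2) = 0 := by
    simp [hφ0]
  have htend : Tendsto (fun q : (Fin p → ℂ) × ℂ => (q.1, φ q.2)) (𝓝 0) (𝓝 0) := by
    simpa only [hΦ0] using hΦ.continuousAt.tendsto
  have hsnd : Tendsto (Prod.snd : (Fin p → ℂ) × ℂ → ℂ) (𝓝 0) (𝓝 0) :=
    continuous_snd.tendsto 0
  have hfst : Tendsto (Prod.fst : (Fin p → ℂ) × ℂ → _) (𝓝 0) (𝓝 0) :=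
    continuous_fst.tendsto 0
  obtain ⟨k, hk, hkη⟩ :=
    (AnalyticAt.comp (g := Prod.snd) (f := η) analyticAt_snd hη).exists_sub_eq_snd_smul
  obtain ⟨ψ, hψan, hψφ⟩ := hφ.exists_deriv_mul_eq hφ0 hφne
  have hdiv : ∀ᶠ q in 𝓝 (0 : (Fin p → ℂ) × ℂ),
      deriv φ q.2 * (k (q.1, φ q.2) * ψ q.2) = (η (q.1, φ q.2)).2 := by
    filter_upwards [htend.eventually hkη, hsnd.eventually hψφ, hfst.eventually hlast]
      with q h₁ h₂ h₃
    simp only [Function.comp_apply, h₃, sub_zero, smul_eq_mul] at h₁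
    rw [h₁, ← h₂]
    ring
  refine ⟨fun q => ((η (q.1, φ q.2)).1, k (q.1, φ q.2) * ψ q.2), ?_, ?_, ?_⟩
  · exact (analyticAt_fst.comp (hη.comp_of_eq hΦ hΦ0)).prod
      ((hk.comp_of_eq hΦ hΦ0).mul (AnalyticAt.comp (g := ψ) (f := Prod.snd) hψan analyticAt_snd))
  · filter_upwards [hdiv] with q hq
    ext i
    · simp [mul_comm]
    · simpa using hq
  · filter_upwards [hdiv, htend.eventually hrel, htend.eventually hH.eventually_analyticAt,
      hsnd.eventually hφ.eventually_analyticAt] with q hq hr hHq hφq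
    have hφd : HasFDerivAt (fun q : (Fin p → ℂ) × ℂ => φ q.2)
        (deriv φ q.2 • ContinuousLinearMap.snd ℂ (Fin p → ℂ) ℂ) q :=
      hφq.differentiableAt.hasDerivAt.comp_hasFDerivAt q hasFDerivAt_snd
    have hfd : fderiv ℂ h q = (fderiv ℂ H (q.1, φ q.2)).comp
        ((ContinuousLinearMap.fst ℂ (Fin p → ℂ) ℂ).prod
          (deriv φ q.2 • ContinuousLinearMap.snd ℂ (Fin p → ℂ) ℂ)) := by
      rw [funext hh]
      exact (HasFDerivAt.comp q (g := H) hHq.differentiableAt.hasFDerivAt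
        (hasFDerivAt_fst.prodMk hφd)).fderiv
    have hsmul : fderiv ℂ H (q.1, φ q.2) (0, deriv φ q.2)
        = deriv φ q.2 * fderiv ℂ H (q.1, φ q.2) (0, 1) := by
      rw [← smul_eq_mul, ← map_smul]
      simp
    rw [hh, ← hr, hfd, ← hq]
    simp [hsmul]
    ring
end

section
/- Let f : (ℂⁿ,0) → (ℂᵖ,0) be a holomorphic map-germ with p ≤ n+1 and of finite 𝒜ₑ-codimension, let F(x,λ) = (f_λ(x), λ) be a one-parameter unfolding of f which is infinitesimally stable, fix an integer k ≥ 1 and let Af : (ℂⁿ×ℂ,0) → (ℂᵖ×ℂ,0) be the augmentation Af(x,z) = (f_{z^k}(x), z). Then the following two sets of holomorphic function germs β : (ℂᵖ,0) → ℂ coincide: { β : there exists η = (η₁,…,η_{p+1}) liftable over Af with η_{p+1}(X,0) = β(X) for all X near 0 } and { β : there exists η = (η₁,…,η_{p+1}) liftable over F with η_{p+1}(X,0) = β(X) for all X near 0 }. (Equivalently, π₂(i*(Lift(Af))) = π₂(i*(Lift(F))), where i(X) = (X,0) and π₂ is the projection onto the last component.) -/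
open Filter Topology

section Superposition

variable {K E G : Type*} [TopologicalSpace K] [CompactSpace K] [NormedAddCommGroup E]
  [NormedSpace ℂ E] [NormedAddCommGroup G] [NormedSpace ℂ G]

/-- The pointwise action of a continuous multilinear map on continuous functions on a compact
space. -/
noncomputable def ContinuousMultilinearMap.pointwise {n : ℕ}
    (p : ContinuousMultilinearMap ℂ (fun _ : Fin n => E) G) :
    ContinuousMultilinearMap ℂ (fun _ : Fin n => C(K, E)) C(K, G) :=
  MultilinearMap.mkContinuous
    { toFun := fun u => ⟨fun t => p fun i => u i t, by fun_prop⟩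
      map_update_add' := by
        intro _ u i a b
        ext t
        have h (c : C(K, E)) : (fun j => Function.update u i c j t)
            = Function.update (fun j => u j t) i (c t) := by
          ext j
          by_cases hj : j = i
          · subst hj; simp
          · simp [hj]
        simp [h]
      map_update_smul' := by
        intro _ u i a b
        ext t
        have h (c : C(K, E)) : (fun j => Function.update u i c j t)
            = Function.update (fun j => u j t) i (c t) := by
          ext j
          by_cases hj : j = i
          · subst hj; simp
          · simp [hj]
        simp [h] } ‖p‖ (by
    intro u
    refine (ContinuousMap.norm_le _ (by positivity)).2 fun t => ?_
    refine (p.le_opNorm _).trans ?_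
    gcongr with i
    exact (u i).norm_coe_le_norm t)

theorem ContinuousMultilinearMap.norm_pointwise_le {n : ℕ}
    (p : ContinuousMultilinearMap ℂ (fun _ : Fin n => E) G) :
    ‖(p.pointwise : ContinuousMultilinearMap ℂ (fun _ : Fin n => C(K, E)) C(K, G))‖ ≤ ‖p‖ :=
  MultilinearMap.mkContinuous_norm_le _ (norm_nonneg _) _

/-- Composition with an analytic germ is an analytic germ between spaces of continuous functions
on a compact space. -/
theorem AnalyticAt.exists_analyticAt_superposition [CompleteSpace G] {g : E → G}
    (hg : AnalyticAt ℂ g 0) :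
    ∃ S : C(K, E) → C(K, G), AnalyticAt ℂ S 0 ∧ ∀ᶠ u in 𝓝 0, ∀ t, S u t = g (u t) := by
  obtain ⟨p, r, hp⟩ := hg
  set P : FormalMultilinearSeries ℂ C(K, E) C(K, G) := fun n => (p n).pointwise with hP
  have hr : r ≤ P.radius := hp.r_le.trans
    (FormalMultilinearSeries.radius_le_of_le fun n => (p n).norm_pointwise_le)
  have hS := P.hasFPowerSeriesOnBall (hp.r_pos.trans_le hr)
  refine ⟨P.sum, hS.analyticAt, ?_⟩
  filter_upwards [Metric.eball_mem_nhds (0 : C(K, E)) hp.r_pos] with u hu t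
  have h1 := (hS.hasSum (Metric.eball_subset_eball hr hu)).mapL (ContinuousMap.evalCLM ℂ t)
  have hut : u t ∈ Metric.eball (0 : E) r := by
    have : ‖u t‖ₑ ≤ ‖u‖ₑ := by
      simpa [enorm_le_iff_norm_le] using u.norm_coe_le_norm t
    simp only [Metric.mem_eball, edist_zero_right] at hu ⊢
    exact this.trans_lt hu
  have h2 := hp.hasSum hut
  simp only [zero_add] at h1 h2
  exact h1.unique h2

end Superposition

/-- The average over the unit circle as a continuous linear functional. -/
noncomputable def circleMeanCLM : C(Circle, ℂ) →L[ℂ] ℂ :=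
  LinearMap.mkContinuous
    { toFun := fun u => (2 * Real.pi)⁻¹ • ∫ θ in 0..2 * Real.pi, u (Circle.exp θ)
      map_add' := by
        intro u v
        simp only [ContinuousMap.add_apply]
        rw [intervalIntegral.integral_add, smul_add]
        all_goals exact Continuous.intervalIntegrable (by fun_prop) _ _
      map_smul' := by
        intro c u
        simp only [ContinuousMap.smul_apply, RingHom.id_apply]
        rw [intervalIntegral.integral_smul, smul_comm] } 1 (by
    intro u
    have h := intervalIntegral.norm_integral_le_of_norm_le_const
      (a := 0) (b := 2 * Real.pi) (f := fun θ => u (Circle.exp θ)) (C := ‖u‖)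
      fun θ _ => u.norm_coe_le_norm _
    have hpi := Real.two_pi_pos
    simp only [LinearMap.coe_mk, AddHom.coe_mk, norm_smul, norm_inv, Real.norm_eq_abs,
      sub_zero, abs_of_pos hpi, one_mul] at h ⊢
    rw [inv_mul_le_iff₀ hpi]
    linarith)

theorem circleMeanCLM_apply (u : C(Circle, ℂ)) (h : ℂ → ℂ) (r : ℝ)
    (hu : ∀ t : Circle, u t = h (r * t)) : circleMeanCLM u = Real.circleAverage h 0 r := by
  simp only [circleMeanCLM, LinearMap.mkContinuous_apply, LinearMap.coe_mk, AddHom.coe_mk, hu,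
    Real.circleAverage_def, circleMap, Circle.coe_exp, zero_add]

theorem sum_pow_mul_div_pow_sub_pow {k : ℕ} {z w : ℂ} (h : w ^ k ≠ z ^ k) :
    ∑ j : Fin k, z ^ (j : ℕ) * (w ^ (k - j) * (w ^ k - z ^ k)⁻¹) = w / (w - z) := by
  have hne : w - z ≠ 0 := fun h0 => h (by rw [sub_eq_zero.1 h0])
  have hne' : w ^ k - z ^ k ≠ 0 := sub_ne_zero.2 h
  have h1 := (Commute.all z w).geom_sum₂_mul k
  rw [Fin.sum_univ_eq_sum_range (fun j => z ^ j * (w ^ (k - j) * (w ^ k - z ^ k)⁻¹))]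
  have h2 : ∑ j ∈ Finset.range k, z ^ j * (w ^ (k - j) * (w ^ k - z ^ k)⁻¹)
      = w * (∑ j ∈ Finset.range k, z ^ j * w ^ (k - 1 - j)) * (w ^ k - z ^ k)⁻¹ := by
    rw [Finset.mul_sum, Finset.sum_mul]
    refine Finset.sum_congr rfl fun j hj => ?_
    have : k - j = k - 1 - j + 1 := by
      have := Finset.mem_range.1 hj
      omega
    rw [this]
    ring
  rw [h2, eq_div_iff hne, mul_assoc, mul_assoc, mul_left_comm, mul_comm w]
  field_simp
  linear_combination (-w) * h1

/-- Every analytic germ `g (x, z)` splits as `∑ j < k, z ^ j * G j (x, z ^ k)` with analytic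
germs `G j`, given by Cauchy-type integrals. -/
theorem exists_powers_decomposition {E : Type*} [NormedAddCommGroup E] [NormedSpace ℂ E]
    {g : E × ℂ → ℂ} (hg : AnalyticAt ℂ g 0) {k : ℕ} (hk : k ≠ 0) :
    ∃ G : Fin k → E × ℂ → ℂ, (∀ j, AnalyticAt ℂ (G j) 0) ∧
      ∀ᶠ q in 𝓝 (0 : E × ℂ), g q = ∑ j : Fin k, q.2 ^ (j : ℕ) * G j (q.1, q.2 ^ k) := by
  obtain ⟨S, hS, hSg⟩ := hg.exists_analyticAt_superposition (K := Circle)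
  obtain ⟨ε, hε, hSε⟩ := Metric.eventually_nhds_iff.1 (hS.eventually_analyticAt.and hSg)
  obtain ⟨δ, hδ, hgδ⟩ := Metric.eventually_nhds_iff.1 hg.eventually_analyticAt
  obtain ⟨r, hr, hrεδ⟩ := exists_between (lt_min hε hδ)
  obtain ⟨hrε, hrδ⟩ := lt_min_iff.1 hrεδ
  have hnorm (t : Circle) : ‖(r : ℂ) * t‖ = r := by simp [abs_of_pos hr, Circle.norm_coe]
  let mono : C(Circle, ℂ) := ⟨fun t => r * t, by fun_prop⟩
  let Φ₀ : E →L[ℂ] C(Circle, E × ℂ) := LinearMap.mkContinuous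
    { toFun := fun x => ContinuousMap.const Circle (x, 0)
      map_add' := by intro x y; ext t <;> simp
      map_smul' := by intro x y; ext t <;> simp } 1 (by
        intro x
        refine (ContinuousMap.norm_le _ (by positivity)).2 fun t => ?_
        simp)
  let Φ : E → C(Circle, E × ℂ) := fun x => Φ₀ x + ⟨fun t => (0, r * t), by fun_prop⟩
  have hΦ (x : E) (t : Circle) : Φ x t = (x, (r : ℂ) * t) := by
    simp [Φ, Φ₀]
  have hΦε (x : E) (hx : ‖x‖ < r) : dist (Φ x) 0 < ε := by
    rw [dist_zero_right]
    refine lt_of_le_of_lt ((ContinuousMap.norm_le _ hr.le).2 fun t => ?_) hrε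
    rw [hΦ, Prod.norm_def, hnorm]
    exact max_le hx.le le_rfl
  have hunit (w : ℂ) (hw : ‖w‖ < r ^ k) : IsUnit (mono ^ k - w • 1) := by
    rw [ContinuousMap.isUnit_iff_forall_ne_zero]
    intro t h0
    have h1 : ((r : ℂ) * t) ^ k = w := by simpa [mono, sub_eq_zero, mul_pow] using h0
    rw [← h1, norm_pow, hnorm] at hw
    exact lt_irrefl _ hw
  have hinv (w : ℂ) (hw : ‖w‖ < r ^ k) (t : Circle) :
      Ring.inverse (mono ^ k - w • 1) t = (((r : ℂ) * t) ^ k - w)⁻¹ := by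
    have h1 := DFunLike.congr_fun (Ring.mul_inverse_cancel _ (hunit w hw)) t
    refine eq_inv_of_mul_eq_one_right ?_
    simpa [mono, mul_pow] using h1
  refine ⟨fun j q => circleMeanCLM
    (mono ^ (k - j) * Ring.inverse (mono ^ k - q.2 • 1) * S (Φ q.1)), fun j => ?_, ?_⟩
  · refine (circleMeanCLM.analyticAt _).comp ?_
    have h1 : AnalyticAt ℂ (fun q : E × ℂ => mono ^ k - q.2 • (1 : C(Circle, ℂ))) 0 := by
      exact analyticAt_const.sub (analyticAt_snd.smul analyticAt_const)
    have hu : IsUnit (mono ^ k - (0 : E × ℂ).2 • (1 : C(Circle, ℂ))) :=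
      hunit _ (by simpa using pow_pos hr k)
    have h2 : AnalyticAt ℂ (fun q : E × ℂ =>
        Ring.inverse (mono ^ k - q.2 • (1 : C(Circle, ℂ)))) 0 := by
      obtain ⟨a, ha⟩ := hu
      exact AnalyticAt.fun_comp (f := fun q : E × ℂ => mono ^ k - q.2 • (1 : C(Circle, ℂ)))
        (ha ▸ analyticAt_inverse a) h1
    have h3 : AnalyticAt ℂ (fun q : E × ℂ => S (Φ q.1)) 0 := by
      have h4 : AnalyticAt ℂ (fun q : E × ℂ => Φ q.1) 0 :=
        ((Φ₀.comp (ContinuousLinearMap.fst ℂ E ℂ)).analyticAt _).add analyticAt_const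
      exact AnalyticAt.fun_comp (f := fun q : E × ℂ => Φ q.1) (hSε (hΦε _ (by simpa using hr))).1 h4
    exact (analyticAt_const.mul h2).mul h3
  · filter_upwards [Metric.ball_mem_nhds (0 : E × ℂ) hr] with ⟨x, z⟩ hq
    rw [mem_ball_zero_iff, Prod.norm_def, max_lt_iff] at hq
    obtain ⟨hx, hz⟩ := hq
    dsimp only at hx hz ⊢
    have hzk : ‖z ^ k‖ < r ^ k := by
      rw [norm_pow]; exact pow_lt_pow_left₀ hz (norm_nonneg _) hk
    have hdiff (w : ℂ) (hw : ‖w‖ ≤ r) : DifferentiableAt ℂ (fun w => g (x, w)) w := by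
      have : AnalyticAt ℂ g (x, w) := hgδ (by
        rw [dist_zero_right, Prod.norm_def]
        exact max_lt (hx.trans hrδ) (hw.trans_lt hrδ))
      exact this.differentiableAt.comp w (by fun_prop)
    have hcl : DiffContOnCl ℂ (fun w => g (x, w)) (Metric.ball 0 |r|) := by
      rw [abs_of_pos hr]
      refine ⟨fun w hw => (hdiff w (mem_ball_zero_iff.1 hw).le).differentiableWithinAt, ?_⟩
      rw [closure_ball _ hr.ne']
      exact fun w hw =>
        (hdiff w (mem_closedBall_zero_iff.1 hw)).continuousAt.continuousWithinAt
    have hzr : z ∈ Metric.ball (0 : ℂ) |r| := by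
      rw [abs_of_pos hr]; simpa using hz
    rw [← hcl.circleAverage_smul_div hzr, ← circleMeanCLM_apply
      (∑ j : Fin k, z ^ (j : ℕ) • (mono ^ (k - j) * Ring.inverse (mono ^ k - z ^ k • 1) * S (Φ x)))]
    · rw [map_sum]
      simp only [map_smul, smul_eq_mul]
    · intro t
      have hpow : ((r : ℂ) * t) ^ k ≠ z ^ k := by
        intro h0
        rw [← h0, norm_pow, hnorm] at hzk
        exact lt_irrefl _ hzk
      rw [sub_zero, ← sum_pow_mul_div_pow_sub_pow hpow, Finset.sum_smul,
        ContinuousMap.sum_apply]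
      refine Finset.sum_congr rfl fun j _ => ?_
      simp only [ContinuousMap.smul_apply, ContinuousMap.mul_apply, ContinuousMap.pow_apply,
        hinv _ hzk, (hSε (hΦε x hx)).2 t, hΦ, smul_eq_mul]
      simp only [mono, ContinuousMap.coe_mk]
      ring

theorem exists_powers_decomposition_pi {E ι : Type*} [NormedAddCommGroup E] [NormedSpace ℂ E]
    [Fintype ι] {g : E × ℂ → ι → ℂ} (hg : AnalyticAt ℂ g 0) {k : ℕ} (hk : k ≠ 0) :
    ∃ G : Fin k → E × ℂ → ι → ℂ, (∀ j, AnalyticAt ℂ (G j) 0) ∧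
      ∀ᶠ q in 𝓝 (0 : E × ℂ), g q = ∑ j : Fin k, q.2 ^ (j : ℕ) • G j (q.1, q.2 ^ k) := by
  choose G hG hsum using fun i => exists_powers_decomposition (analyticAt_pi_iff.1 hg i) hk
  refine ⟨fun j q i => G i j q, fun j => analyticAt_pi_iff.2 fun i => hG i j, ?_⟩
  filter_upwards [eventually_all.2 hsum] with q hq
  ext i
  simp [hq i]

theorem eventually_forall_pow_eq {E : Type*} [NormedAddCommGroup E] {P : E × ℂ → Prop}
    (h : ∀ᶠ q in 𝓝 (0 : E × ℂ), P q) (k : ℕ) :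
    ∀ᶠ q in 𝓝 (0 : E × ℂ), ∀ z : ℂ, z ^ k = q.2 → P (q.1, z) := by
  obtain ⟨ε, hε, hP⟩ := Metric.eventually_nhds_iff.1 h
  filter_upwards [Metric.ball_mem_nhds (0 : E × ℂ) (lt_min hε (pow_pos hε k))] with q hq z hz
  rw [mem_ball_zero_iff, Prod.norm_def, lt_min_iff, max_lt_iff, max_lt_iff, ← hz, norm_pow] at hq
  apply hP
  rw [dist_zero_right, Prod.norm_def]
  exact max_lt hq.1.1 (lt_of_pow_lt_pow_left₀ k hε.le hq.2.2)

theorem eq_zero_of_forall_pow_eq_sum_pow_smul_eq_zero {ι : Type*} {k : ℕ} {w : ℂ} (hw : w ≠ 0)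
    {v : Fin k → ι → ℂ} (h : ∀ z : ℂ, z ^ k = w → ∑ j : Fin k, z ^ (j : ℕ) • v j = 0) :
    v = 0 := by
  rcases eq_or_ne k 0 with rfl | hk
  · exact Subsingleton.elim _ _
  obtain ⟨z, hz⟩ := IsAlgClosed.exists_pow_nat_eq w (Nat.pos_of_ne_zero hk)
  have hz0 : z ≠ 0 := by
    rintro rfl
    exact hw (by rw [← hz, zero_pow hk])
  have hω := Complex.isPrimitiveRoot_exp k hk
  set ω := Complex.exp (2 * Real.pi * Complex.I / k)
  have hinj : Function.Injective fun i : Fin k => ω ^ (i : ℕ) * z := fun i j hij =>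
    Fin.ext (hω.pow_inj i.2 j.2 (mul_right_cancel₀ hz0 hij))
  ext j i
  refine congrFun (Matrix.eq_zero_of_forall_index_sum_pow_mul_eq_zero (v := fun j => v j i) hinj
    fun l => ?_) j
  have := congrFun (h (ω ^ (l : ℕ) * z) (by
    rw [mul_pow, ← pow_mul, mul_comm (l : ℕ), pow_mul, hω.pow_eq_one, one_pow, one_mul, hz])) i
  simpa using this

theorem eventually_eq_of_eventually_snd_ne_zero {E H : Type*} [NormedAddCommGroup E]
    [NormedSpace ℂ E] [NormedAddCommGroup H] [NormedSpace ℂ H] [CompleteSpace H]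
    {a b : E × ℂ → H} (ha : AnalyticAt ℂ a 0) (hb : AnalyticAt ℂ b 0)
    (h : ∀ᶠ q in 𝓝 (0 : E × ℂ), q.2 ≠ 0 → a q = b q) : ∀ᶠ q in 𝓝 (0 : E × ℂ), a q = b q := by
  filter_upwards [ha.eventually_analyticAt, hb.eventually_analyticAt, h.eventually_nhds]
    with q hqa hqb hq
  by_cases h0 : q.2 = 0
  · have hpath : Tendsto (fun t : ℂ => (q.1, t)) (𝓝[≠] 0) (𝓝 q) := by
      have : Continuous fun t : ℂ => (q.1, t) := by fun_prop
      have h1 := this.tendsto 0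
      rw [← h0] at h1
      exact h1.mono_left (by rw [h0]; exact nhdsWithin_le_nhds)
    refine tendsto_nhds_unique (hqa.continuousAt.tendsto.comp hpath) ?_
    refine (hqb.continuousAt.tendsto.comp hpath).congr' ?_
    filter_upwards [hpath.eventually hq, self_mem_nhdsWithin] with t ht ht0
    exact (ht ht0).symm
  · exact hq.self_of_nhds h0

section Unfolding

variable {E H : Type*} [NormedAddCommGroup E] [NormedSpace ℂ E] [NormedAddCommGroup H]
  [NormedSpace ℂ H]

theorem fderiv_unfolding_apply {φ : E × ℂ → H} {q : E × ℂ} (hφ : DifferentiableAt ℂ φ q)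
    (v : E × ℂ) : fderiv ℂ (fun q => (φ q, q.2)) q v = (fderiv ℂ φ q v, v.2) := by
  have := hφ.hasFDerivAt.prodMk (hasFDerivAt_snd (𝕜 := ℂ) (p := q))
  rw [this.fderiv]
  rfl

theorem fderiv_augmentation_apply {φ : E × ℂ → H} {q : E × ℂ} {k : ℕ}
    (hφ : DifferentiableAt ℂ φ (q.1, q.2 ^ k)) (v : E × ℂ) :
    fderiv ℂ (fun q => (φ (q.1, q.2 ^ k), q.2)) q v
      = (fderiv ℂ φ (q.1, q.2 ^ k) (v.1, (k * q.2 ^ (k - 1)) * v.2), v.2) := by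
  have h1 : HasFDerivAt (fun q : E × ℂ => q.2 ^ k) _ q :=
    (hasDerivAt_pow k q.2).comp_hasFDerivAt q (hasFDerivAt_snd (𝕜 := ℂ) (p := q))
  have h2 : HasFDerivAt (fun q : E × ℂ => (q.1, q.2 ^ k)) _ q := hasFDerivAt_fst.prodMk h1
  have h3 := (hφ.hasFDerivAt.comp q h2).prodMk (hasFDerivAt_snd (𝕜 := ℂ) (p := q))
  have h4 : fderiv ℂ (fun q => (φ (q.1, q.2 ^ k), q.2)) q = _ := h3.fderiv
  rw [h4]
  rfl

theorem AnalyticAt.comp_augmentation_base {φ : E × ℂ → H} (hφ : AnalyticAt ℂ φ 0) {k : ℕ}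
    (hk : k ≠ 0) : AnalyticAt ℂ (fun q : E × ℂ => φ (q.1, q.2 ^ k)) 0 := by
  refine AnalyticAt.fun_comp (f := fun q : E × ℂ => (q.1, q.2 ^ k)) ?_
    (analyticAt_fst.prod (analyticAt_snd.pow k))
  have h0 : ((0 : E × ℂ).1, (0 : E × ℂ).2 ^ k) = 0 := by simp [hk]
  rwa [h0]

theorem AnalyticAt.comp_unfolding {W : Type*} [NormedAddCommGroup W] [NormedSpace ℂ W]
    {φ : E × ℂ → H} (hφ : AnalyticAt ℂ φ 0) (hφ0 : φ 0 = 0) {g : H × ℂ → W}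
    (hg : AnalyticAt ℂ g 0) : AnalyticAt ℂ (fun q => g (φ q, q.2)) 0 := by
  refine AnalyticAt.fun_comp (f := fun q : E × ℂ => (φ q, q.2)) ?_ (hφ.prod analyticAt_snd)
  have h0 : (φ 0, (0 : E × ℂ).2) = 0 := by rw [hφ0]; rfl
  rwa [h0]

end Unfolding

theorem exists_liftable_augmentation_of_liftable_unfolding {E H : Type*} [NormedAddCommGroup E]
    [NormedSpace ℂ E] [NormedAddCommGroup H] [NormedSpace ℂ H] {k : ℕ} (hk : k ≠ 0)
    {φ : E × ℂ → H} [CompleteSpace H] (hφ : AnalyticAt ℂ φ 0)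
    {η : H × ℂ → H × ℂ} {ξ : E × ℂ → E × ℂ} {β : H → ℂ}
    (hη : AnalyticAt ℂ η 0) (hξ : AnalyticAt ℂ ξ 0)
    (hlift : ∀ᶠ q in 𝓝 (0 : E × ℂ), fderiv ℂ (fun q => (φ q, q.2)) q (ξ q) = η (φ q, q.2))
    (hβ : ∀ᶠ X in 𝓝 (0 : H), (η (X, 0)).2 = β X) :
    ∃ (η' : H × ℂ → H × ℂ) (ξ' : E × ℂ → E × ℂ), AnalyticAt ℂ η' 0 ∧ AnalyticAt ℂ ξ' 0 ∧
      (∀ᶠ q in 𝓝 (0 : E × ℂ), fderiv ℂ (fun q => (φ (q.1, q.2 ^ k), q.2)) q (ξ' q)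
        = η' (φ (q.1, q.2 ^ k), q.2)) ∧
      ∀ᶠ X in 𝓝 (0 : H), (η' (X, 0)).2 = β X := by
  have hη' := hη.comp_augmentation_base hk
  have hξ' := hξ.comp_augmentation_base hk
  refine ⟨fun Y => ((k * Y.2 ^ (k - 1)) • (η (Y.1, Y.2 ^ k)).1, (η (Y.1, Y.2 ^ k)).2),
    fun q => ((k * q.2 ^ (k - 1)) • (ξ (q.1, q.2 ^ k)).1, (ξ (q.1, q.2 ^ k)).2), ?_, ?_, ?_, ?_⟩
  · exact ((analyticAt_const.mul (analyticAt_snd.pow _)).smul (analyticAt_fst.fun_comp hη')).prod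
      (analyticAt_snd.fun_comp hη')
  · exact ((analyticAt_const.mul (analyticAt_snd.pow _)).smul (analyticAt_fst.fun_comp hξ')).prod
      (analyticAt_snd.fun_comp hξ')
  · have htend : Tendsto (fun q : E × ℂ => (q.1, q.2 ^ k)) (𝓝 0) (𝓝 0) := by
      have h : Continuous fun q : E × ℂ => (q.1, q.2 ^ k) := by fun_prop
      have h1 := h.tendsto 0
      have h0 : ((0 : E × ℂ).1, (0 : E × ℂ).2 ^ k) = 0 := by simp [hk]
      rwa [h0] at h1
    have hdiff := hφ.eventually_analyticAt.mono fun q hq => hq.differentiableAt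
    filter_upwards [htend.eventually hlift, htend.eventually hdiff] with q hq hd
    rw [fderiv_unfolding_apply hd] at hq
    rw [fderiv_augmentation_apply hd]
    have h1 := congrArg Prod.fst hq
    have h2 := congrArg Prod.snd hq
    refine Prod.ext ?_ h2
    dsimp only at h1 ⊢
    rw [← h1, ← map_smul]
    rfl
  · simpa [hk] using hβ

theorem exists_liftable_unfolding_of_liftable_augmentation {ι κ : Type*} [Fintype ι] [Fintype κ]
    {k : ℕ} (hk : k ≠ 0) {φ : (ι → ℂ) × ℂ → κ → ℂ} (hφ : AnalyticAt ℂ φ 0) (hφ0 : φ 0 = 0)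
    {η : (κ → ℂ) × ℂ → (κ → ℂ) × ℂ} {ξ : (ι → ℂ) × ℂ → (ι → ℂ) × ℂ} {β : (κ → ℂ) → ℂ}
    (hη : AnalyticAt ℂ η 0) (hξ : AnalyticAt ℂ ξ 0)
    (hlift : ∀ᶠ q in 𝓝 (0 : (ι → ℂ) × ℂ), fderiv ℂ (fun q => (φ (q.1, q.2 ^ k), q.2)) q (ξ q)
        = η (φ (q.1, q.2 ^ k), q.2))
    (hβ : ∀ᶠ X in 𝓝 (0 : κ → ℂ), (η (X, 0)).2 = β X) :
    ∃ (η' : (κ → ℂ) × ℂ → (κ → ℂ) × ℂ) (ξ' : (ι → ℂ) × ℂ → (ι → ℂ) × ℂ),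
      AnalyticAt ℂ η' 0 ∧ AnalyticAt ℂ ξ' 0 ∧
      (∀ᶠ q in 𝓝 (0 : (ι → ℂ) × ℂ), fderiv ℂ (fun q => (φ q, q.2)) q (ξ' q)
        = η' (φ q, q.2)) ∧
      ∀ᶠ X in 𝓝 (0 : κ → ℂ), (η' (X, 0)).2 = β X := by
  obtain ⟨m, rfl⟩ := Nat.exists_eq_succ_of_ne_zero hk
  rw [Nat.succ_eq_add_one] at *
  obtain ⟨a, ha, hsa⟩ := exists_powers_decomposition_pi (analyticAt_fst.fun_comp hξ) hk
  obtain ⟨b, hb, hsb⟩ := exists_powers_decomposition_pi (analyticAt_fst.fun_comp hη) hk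
  obtain ⟨c, hc, hsc⟩ := exists_powers_decomposition (analyticAt_snd.fun_comp hη) hk
  have hm : ((m + 1 : ℕ) : ℂ) ≠ 0 := Nat.cast_ne_zero.2 hk
  have hdiff := hφ.eventually_analyticAt.mono fun q hq => hq.differentiableAt
  have htendAf : Tendsto (fun q : (ι → ℂ) × ℂ => (φ (q.1, q.2 ^ (m + 1)), q.2)) (𝓝 0) (𝓝 0) := by
    have h1 := ((hφ.comp_augmentation_base hk).prod analyticAt_snd).continuousAt.tendsto
    have h0 : (φ ((0 : (ι → ℂ) × ℂ).1, (0 : (ι → ℂ) × ℂ).2 ^ (m + 1)), (0 : (ι → ℂ) × ℂ).2)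
        = 0 := by
      rw [Prod.snd_zero, zero_pow hk]
      exact Prod.ext hφ0 rfl
    rwa [h0] at h1
  refine ⟨fun Y => (((m + 1 : ℕ) : ℂ)⁻¹ • b (Fin.last m) Y, c 0 Y),
    fun q => (((m + 1 : ℕ) : ℂ)⁻¹ • a (Fin.last m) q, c 0 (φ q, q.2)), ?_, ?_, ?_, ?_⟩
  · exact ((hb _).fun_const_smul).prod (hc 0)
  · exact ((ha _).fun_const_smul).prod (hφ.comp_unfolding hφ0 (hc 0))
  · have key : ∀ᶠ q in 𝓝 (0 : (ι → ℂ) × ℂ),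
        fderiv ℂ φ q (a (Fin.last m) q, ((m + 1 : ℕ) : ℂ) * c 0 (φ q, q.2))
          = b (Fin.last m) (φ q, q.2) := by
      refine eventually_eq_of_eventually_snd_ne_zero ?_ ?_ ?_
      · exact AnalyticAt.fun_comp
          (f := fun q => (fderiv ℂ φ q, (a (Fin.last m) q, ((m + 1 : ℕ) : ℂ) * c 0 (φ q, q.2))))
          ((ContinuousLinearMap.id ℂ ((ι → ℂ) × ℂ →L[ℂ] κ → ℂ)).analyticAt_bilinear _)
          (hφ.fderiv.prod <| (ha _).prod (analyticAt_const.mul (hφ.comp_unfolding hφ0 (hc 0))))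
      · exact hφ.comp_unfolding hφ0 (hb _)
      · filter_upwards [hdiff, eventually_forall_pow_eq hlift (m + 1), eventually_forall_pow_eq hsa (m + 1),
          eventually_forall_pow_eq (htendAf.eventually hsb) (m + 1),
          eventually_forall_pow_eq (htendAf.eventually hsc) (m + 1)] with q hd hl hqa hqb hqc hw
        set C : Fin (m + 1) → ℂ := Fin.lastCases (((m + 1 : ℕ) : ℂ) * c 0 (φ q, q.2))
          fun j => ((m + 1 : ℕ) : ℂ) * q.2 * c j.succ (φ q, q.2) with hC
        have hv := eq_zero_of_forall_pow_eq_sum_pow_smul_eq_zero (k := m + 1) hw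
          (v := fun j => fderiv ℂ φ q (a j q, C j) - b j (φ q, q.2)) ?_
        · have := congrFun hv (Fin.last m)
          simpa [hC, sub_eq_zero] using this
        · intro z hz
          have hd' : DifferentiableAt ℂ φ (q.1, z ^ (m + 1)) := by rw [hz]; exact hd
          have hl' := hl z hz
          rw [fderiv_augmentation_apply (q := (q.1, z)) hd'] at hl'
          have hqa' := hqa z hz
          have hqb' := hqb z hz
          have hqc' := hqc z hz
          have h2 := congrArg Prod.snd hl'
          have h1 := congrArg Prod.fst hl'
          dsimp only at h1 h2 hqa' hqb' hqc'
          rw [h2, hqa', hqb', hqc'] at h1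
          simp only [hz] at h1
          have hCsum : ((m + 1 : ℕ) : ℂ) * z ^ (m + 1 - 1)
              * ∑ j : Fin (m + 1), z ^ (j : ℕ) * c j (φ q, q.2)
                = ∑ j : Fin (m + 1), z ^ (j : ℕ) * C j := by
            rw [Fin.sum_univ_succ, Fin.sum_univ_castSucc (fun j => z ^ (j : ℕ) * C j)]
            simp only [hC, Fin.lastCases_castSucc, Fin.lastCases_last, Fin.val_zero, Fin.val_succ,
              Fin.val_castSucc, Fin.val_last, ← hz, Nat.add_sub_cancel, mul_add, Finset.mul_sum]
            rw [add_comm]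
            congr 1
            · exact Finset.sum_congr rfl fun j _ => by ring
            · ring
          simp only [smul_sub, Finset.sum_sub_distrib, ← map_smul, ← map_sum]
          rw [sub_eq_zero, ← h1]
          congr 1
          refine Prod.ext ?_ ?_
          · simp [Prod.fst_sum]
          · rw [hCsum]
            simp [Prod.snd_sum]
    filter_upwards [key, hdiff] with q hq hd
    rw [fderiv_unfolding_apply hd]
    refine Prod.ext ?_ rfl
    dsimp only
    rw [← hq, ← map_smul]
    congr 1
    simp only [Prod.smul_mk, smul_eq_mul, inv_mul_cancel_left₀ hm]
  · have htend : Tendsto (fun X : κ → ℂ => (X, (0 : ℂ))) (𝓝 0) (𝓝 0) :=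
      (by fun_prop : Continuous fun X : κ → ℂ => (X, (0 : ℂ))).tendsto 0
    filter_upwards [htend.eventually hsc, hβ] with X hX hX'
    rw [← hX', hX, Fin.sum_univ_succ]
    simp

/-- for `f : (ℂⁿ,0) → (ℂᵖ,0)` with `p ≤ n+1` of finite 𝒜ₑ-codimension, with
infinitesimally stable one-parameter unfolding `F(x,λ) = (f_λ(x),λ)`, and the augmentation
`Af(x,z) = (f_{z^k}(x),z)`, the sets of germs `β(X) = η_{p+1}(X,0)` arising from `η`
liftable over `Af` and from `η` liftable over `F` coincide:
`π₂(i*(Lift(Af))) = π₂(i*(Lift(F)))`. -/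
theorem pi2_lift_augmentation_eq_pi2_lift_unfolding
    (n p : ℕ) (hp : p ≤ n + 1) (k : ℕ) (hk : 1 ≤ k)
    (f : (Fin n → ℂ) → (Fin p → ℂ)) (hf : AnalyticAt ℂ f 0) (hf0 : f 0 = 0)
    (fhat : (Fin n → ℂ) × ℂ → (Fin p → ℂ)) (hfhat : AnalyticAt ℂ fhat 0)
    (hunf : ∀ x : Fin n → ℂ, fhat (x, 0) = f x)
    (F : (Fin n → ℂ) × ℂ → (Fin p → ℂ) × ℂ)
    (hF : ∀ q : (Fin n → ℂ) × ℂ, F q = (fhat q, q.2))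
    (Af : (Fin n → ℂ) × ℂ → (Fin p → ℂ) × ℂ)
    (hAf : ∀ q : (Fin n → ℂ) × ℂ, Af q = (fhat (q.1, q.2 ^ k), q.2))
    -- f has finite 𝒜ₑ-codimension:
    (hcodim : ∃ (m : ℕ) (νs : Fin m → ((Fin n → ℂ) → (Fin p → ℂ))),
      (∀ j, AnalyticAt ℂ (νs j) 0) ∧
      ∀ ν : (Fin n → ℂ) → (Fin p → ℂ), AnalyticAt ℂ ν 0 →
        ∃ (c : Fin m → ℂ) (ξ : (Fin n → ℂ) → (Fin n → ℂ))
          (η : (Fin p → ℂ) → (Fin p → ℂ)),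
          AnalyticAt ℂ ξ 0 ∧ AnalyticAt ℂ η 0 ∧
          ∀ᶠ x in 𝓝 (0 : Fin n → ℂ),
            ν x = ∑ j, c j • νs j x + fderiv ℂ f x (ξ x) + η (f x))
    -- F is infinitesimally stable:
    (hstab : ∀ ν : (Fin n → ℂ) × ℂ → (Fin p → ℂ) × ℂ, AnalyticAt ℂ ν 0 →
      ∃ (ξ : (Fin n → ℂ) × ℂ → (Fin n → ℂ) × ℂ)
        (η : (Fin p → ℂ) × ℂ → (Fin p → ℂ) × ℂ),
        AnalyticAt ℂ ξ 0 ∧ AnalyticAt ℂ η 0 ∧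
        ∀ᶠ q in 𝓝 (0 : (Fin n → ℂ) × ℂ), ν q = fderiv ℂ F q (ξ q) + η (F q)) :
    {β : (Fin p → ℂ) → ℂ |
      ∃ (η : (Fin p → ℂ) × ℂ → (Fin p → ℂ) × ℂ)
        (ξ : (Fin n → ℂ) × ℂ → (Fin n → ℂ) × ℂ),
        AnalyticAt ℂ η 0 ∧ AnalyticAt ℂ ξ 0 ∧
        (∀ᶠ q in 𝓝 (0 : (Fin n → ℂ) × ℂ), fderiv ℂ Af q (ξ q) = η (Af q)) ∧
        (∀ᶠ X in 𝓝 (0 : Fin p → ℂ), (η (X, 0)).2 = β X)}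
    = {β : (Fin p → ℂ) → ℂ |
      ∃ (η : (Fin p → ℂ) × ℂ → (Fin p → ℂ) × ℂ)
        (ξ : (Fin n → ℂ) × ℂ → (Fin n → ℂ) × ℂ),
        AnalyticAt ℂ η 0 ∧ AnalyticAt ℂ ξ 0 ∧
        (∀ᶠ q in 𝓝 (0 : (Fin n → ℂ) × ℂ), fderiv ℂ F q (ξ q) = η (F q)) ∧
        (∀ᶠ X in 𝓝 (0 : Fin p → ℂ), (η (X, 0)).2 = β X)} := by
  obtain rfl : F = fun q => (fhat q, q.2) := funext hF
  obtain rfl : Af = fun q => (fhat (q.1, q.2 ^ k), q.2) := funext hAf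
  have hk0 : k ≠ 0 := by omega
  have hfhat0 : fhat 0 = 0 := (hunf 0).trans hf0
  ext β
  constructor
  · rintro ⟨η, ξ, hη, hξ, hlift, hβ⟩
    exact exists_liftable_unfolding_of_liftable_augmentation hk0 hfhat hfhat0 hη hξ hlift hβ
  · rintro ⟨η, ξ, hη, hξ, hlift, hβ⟩
    exact exists_liftable_augmentation_of_liftable_unfolding hk0 hfhat hη hξ hlift hβ
end

section
/- Let f : (ℂⁿ,0) → (ℂᵖ,0) be a holomorphic map-germ, F(x,λ) = (f_λ(x), λ) a one-parameter unfolding of f, φ : (ℂ,0) → (ℂ,0) a holomorphic germ with φ(0) = 0, Af(x,z) = (f_{φ(z)}(x), z) the augmentation, and AF(x,z,μ) = (f_{φ(z)+μ}(x), z, μ) the associated one-parameter unfolding of Af. Assume AF is infinitesimally stable. If β : (ℂᵖ,0) → ℂ is a holomorphic germ such that there exists η = (η₁,…,η_{p+1}) liftable over F with η_{p+1}(X,0) = β(X) for all X near 0, then there exists η̄ = (η̄₁,…,η̄_{p+1}) liftable over Af with η̄_{p+1}(X,0) = β(X) for all X near 0. That is, π₂(i*(Lift(F))) ⊆ π₂(i*(Lift(Af))).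 -/
open Filter Topology

/-- The derivative of the unfolding `(u, t) ↦ (g (u, t), t)`. -/
theorem fderiv_prodMk_snd_apply {E V : Type*} [NormedAddCommGroup E] [NormedSpace ℂ E]
    [NormedAddCommGroup V] [NormedSpace ℂ V] {g : E × ℂ → V} {q : E × ℂ}
    (hg : DifferentiableAt ℂ g q) (v : E × ℂ) :
    fderiv ℂ (fun q => (g q, q.2)) q v = (fderiv ℂ g q v, v.2) := by
  rw [(hg.hasFDerivAt.prodMk hasFDerivAt_snd).fderiv]
  rfl

/-- The derivative of `g` after reparametrising its second variable by `φ`. -/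
theorem hasFDerivAt_comp_reparam {E V : Type*} [NormedAddCommGroup E] [NormedSpace ℂ E]
    [NormedAddCommGroup V] [NormedSpace ℂ V] {g : E × ℂ → V} {φ : ℂ → ℂ} {q : E × ℂ}
    (hg : DifferentiableAt ℂ g (q.1, φ q.2)) (hφ : DifferentiableAt ℂ φ q.2) :
    HasFDerivAt (fun q : E × ℂ => g (q.1, φ q.2))
      ((fderiv ℂ g (q.1, φ q.2)).comp ((ContinuousLinearMap.fst ℂ E ℂ).prod
        (deriv φ q.2 • ContinuousLinearMap.snd ℂ E ℂ))) q :=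
  HasFDerivAt.comp (g := g) q hg.hasFDerivAt
    (hasFDerivAt_fst.prodMk (hφ.hasDerivAt.comp_hasFDerivAt q hasFDerivAt_snd))

/-- let `F(x,λ) = (f_λ(x),λ)` be a one-parameter unfolding of `f`,
`φ : (ℂ,0) → (ℂ,0)` holomorphic, `Af(x,z) = (f_{φ(z)}(x),z)` the augmentation and
`AF(x,z,μ) = (f_{φ(z)+μ}(x),z,μ)` the associated one-parameter unfolding of `Af`, assumed
infinitesimally stable. If `β` is realised as `η_{p+1}(·,0)` for some `η` liftable over `F`,
then it is realised as `η̄_{p+1}(·,0)` for some `η̄` liftable over `Af`: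
`π₂(i*(Lift(F))) ⊆ π₂(i*(Lift(Af)))`. -/
theorem pi2_lift_unfolding_subset_pi2_lift_augmentation
    (n p : ℕ)
    (f : (Fin n → ℂ) → (Fin p → ℂ)) (hf : AnalyticAt ℂ f 0) (hf0 : f 0 = 0)
    (fhat : (Fin n → ℂ) × ℂ → (Fin p → ℂ)) (hfhat : AnalyticAt ℂ fhat 0)
    (hunf : ∀ x : Fin n → ℂ, fhat (x, 0) = f x)
    (F : (Fin n → ℂ) × ℂ → (Fin p → ℂ) × ℂ)
    (hF : ∀ q : (Fin n → ℂ) × ℂ, F q = (fhat q, q.2))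
    (φ : ℂ → ℂ) (hφ : AnalyticAt ℂ φ 0) (hφ0 : φ 0 = 0)
    (Af : (Fin n → ℂ) × ℂ → (Fin p → ℂ) × ℂ)
    (hAf : ∀ q : (Fin n → ℂ) × ℂ, Af q = (fhat (q.1, φ q.2), q.2))
    (AF : (Fin n → ℂ) × ℂ × ℂ → (Fin p → ℂ) × ℂ × ℂ)
    (hAF : ∀ q : (Fin n → ℂ) × ℂ × ℂ,
      AF q = (fhat (q.1, φ q.2.1 + q.2.2), q.2.1, q.2.2))
    -- AF is infinitesimally stable:
    (hstab : ∀ ν : (Fin n → ℂ) × ℂ × ℂ → (Fin p → ℂ) × ℂ × ℂ, AnalyticAt ℂ ν 0 →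
      ∃ (ξ : (Fin n → ℂ) × ℂ × ℂ → (Fin n → ℂ) × ℂ × ℂ)
        (η : (Fin p → ℂ) × ℂ × ℂ → (Fin p → ℂ) × ℂ × ℂ),
        AnalyticAt ℂ ξ 0 ∧ AnalyticAt ℂ η 0 ∧
        ∀ᶠ q in 𝓝 (0 : (Fin n → ℂ) × ℂ × ℂ), ν q = fderiv ℂ AF q (ξ q) + η (AF q))
    (β : (Fin p → ℂ) → ℂ)
    -- β ∈ π₂(i*(Lift(F))):
    (hβ : ∃ (η : (Fin p → ℂ) × ℂ → (Fin p → ℂ) × ℂ)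
        (ξ : (Fin n → ℂ) × ℂ → (Fin n → ℂ) × ℂ),
        AnalyticAt ℂ η 0 ∧ AnalyticAt ℂ ξ 0 ∧
        (∀ᶠ q in 𝓝 (0 : (Fin n → ℂ) × ℂ), fderiv ℂ F q (ξ q) = η (F q)) ∧
        (∀ᶠ X in 𝓝 (0 : Fin p → ℂ), (η (X, 0)).2 = β X)) :
    -- then β ∈ π₂(i*(Lift(Af))):
    ∃ (ηbar : (Fin p → ℂ) × ℂ → (Fin p → ℂ) × ℂ)
      (ξbar : (Fin n → ℂ) × ℂ → (Fin n → ℂ) × ℂ),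
      AnalyticAt ℂ ηbar 0 ∧ AnalyticAt ℂ ξbar 0 ∧
      (∀ᶠ q in 𝓝 (0 : (Fin n → ℂ) × ℂ), fderiv ℂ Af q (ξbar q) = ηbar (Af q)) ∧
      (∀ᶠ X in 𝓝 (0 : Fin p → ℂ), (ηbar (X, 0)).2 = β X) := by
  obtain ⟨η, ξ, hη, hξ, hlift, hlast⟩ := hβ
  obtain rfl : F = fun q => (fhat q, q.2) := funext hF
  obtain rfl : Af = fun q => (fhat (q.1, φ q.2), q.2) := funext hAf
  have hφ' : AnalyticAt ℂ (deriv φ) 0 := hφ.deriv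
  have hφs {k : ℕ} : AnalyticAt ℂ (fun q : (Fin k → ℂ) × ℂ => φ q.2) 0 :=
    AnalyticAt.fun_comp (g := φ) hφ analyticAt_snd
  have hφs' {k : ℕ} : AnalyticAt ℂ (fun q : (Fin k → ℂ) × ℂ => deriv φ q.2) 0 :=
    AnalyticAt.fun_comp (g := deriv φ) hφ' analyticAt_snd
  have hG {k : ℕ} : AnalyticAt ℂ (fun q : (Fin k → ℂ) × ℂ => (q.1, φ q.2)) 0 :=
    analyticAt_fst.prod hφs
  have hG0 {k : ℕ} :
      (fun q : (Fin k → ℂ) × ℂ => (q.1, φ q.2)) 0 = (0 : (Fin k → ℂ) × ℂ) := by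
    simp [hφ0]
  have hηG : AnalyticAt ℂ (fun q : (Fin p → ℂ) × ℂ => η (q.1, φ q.2)) 0 :=
    AnalyticAt.fun_comp_of_eq hη hG hG0
  have hξG : AnalyticAt ℂ (fun q : (Fin n → ℂ) × ℂ => ξ (q.1, φ q.2)) 0 :=
    AnalyticAt.fun_comp_of_eq hξ hG hG0
  refine ⟨fun Y => (deriv φ Y.2 • (η (Y.1, φ Y.2)).1, (η (Y.1, φ Y.2)).2),
    fun q => (deriv φ q.2 • (ξ (q.1, φ q.2)).1, (ξ (q.1, φ q.2)).2),
    (hφs'.smul (analyticAt_fst.comp hηG)).prod (analyticAt_snd.comp hηG),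
    (hφs'.smul (analyticAt_fst.comp hξG)).prod (analyticAt_snd.comp hξG), ?_, ?_⟩
  · have hGt : Tendsto (fun q : (Fin n → ℂ) × ℂ => (q.1, φ q.2)) (𝓝 0) (𝓝 0) := by
      simpa only [ContinuousAt, hG0] using hG.continuousAt
    have hst : Tendsto (fun q : (Fin n → ℂ) × ℂ => q.2) (𝓝 0) (𝓝 0) :=
      continuous_snd.tendsto' _ _ rfl
    filter_upwards [hGt.eventually hlift, hGt.eventually hfhat.eventually_analyticAt,
      hst.eventually hφ.eventually_analyticAt] with q hq hgq hφq
    have hcomp := hasFDerivAt_comp_reparam hgq.differentiableAt hφq.differentiableAt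
    rw [fderiv_prodMk_snd_apply hgq.differentiableAt] at hq
    rw [fderiv_prodMk_snd_apply hcomp.differentiableAt, hcomp.fderiv]
    have h1 := congrArg Prod.fst hq
    have h2 := congrArg Prod.snd hq
    simp only at h1 h2
    ext1
    · simp only [← h1, ← map_smul]
      rfl
    · exact h2
  · filter_upwards [hlast] with X hX
    simpa only [hφ0] using hX
end

section
/- Let F : ℂ³ → ℂ³ be F(x,y,z) = (x⁴+yx+zx², y, z). Each of the following three polynomial vector fields on ℂ³ (in coordinates (X,Y,Z)) is liftable over F: η¹ = (4X, 3Y, 2Z); η² = (−9Y²−16XZ, 12YZ, 48X+4Z²); η³ = (YZ, −8X−2Z², 6Y). -/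
open Filter Topology

theorem fderiv_swallowtail_unfolding_apply
    (F : (Fin 3 → ℂ) → (Fin 3 → ℂ))
    (hF : ∀ v : Fin 3 → ℂ,
      F v = ![(v 0) ^ 4 + v 1 * v 0 + v 2 * (v 0) ^ 2, v 1, v 2])
    (v w : Fin 3 → ℂ) :
    fderiv ℂ F v w =
      ![(4 * v 0 ^ 3 + v 1 + 2 * v 2 * v 0) * w 0 + v 0 * w 1 + v 0 ^ 2 * w 2, w 1, w 2] := by
  obtain rfl : F = fun v => ![(v 0) ^ 4 + v 1 * v 0 + v 2 * (v 0) ^ 2, v 1, v 2] := funext hF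
  have hx (i : Fin 3) : HasFDerivAt (fun u : Fin 3 → ℂ => u i)
      (ContinuousLinearMap.proj (R := ℂ) (φ := fun _ : Fin 3 => ℂ) i) v := hasFDerivAt_apply i v
  have h := (((hx 0).pow 4).add ((hx 1).mul (hx 0))).add ((hx 2).mul ((hx 0).pow 2))
  have hd : DifferentiableAt ℂ
      (fun v : Fin 3 → ℂ => ![(v 0) ^ 4 + v 1 * v 0 + v 2 * (v 0) ^ 2, v 1, v 2]) v := by
    rw [differentiableAt_pi]
    intro i
    fin_cases i
    · exact h.differentiableAt
    · exact (hx 1).differentiableAt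
    · exact (hx 2).differentiableAt
  have hc := hasFDerivAt_pi'.1 hd.hasFDerivAt
  ext i
  fin_cases i
  · have e := congrArg (fun L => L w) ((hc 0).unique h)
    simp at e ⊢
    rw [e]
    ring
  · exact congrArg (fun L => L w) ((hc 1).unique (hx 1))
  · exact congrArg (fun L => L w) ((hc 2).unique (hx 2))

/-- A vector field whose components along the unfolding parameters are forced lifts as soon as
the first component satisfies the remaining scalar equation with an analytic coefficient. -/
theorem liftable_swallowtail_unfolding_of_analyticAt
    (F : (Fin 3 → ℂ) → (Fin 3 → ℂ))
    (hF : ∀ v : Fin 3 → ℂ,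
      F v = ![(v 0) ^ 4 + v 1 * v 0 + v 2 * (v 0) ^ 2, v 1, v 2])
    (η : (Fin 3 → ℂ) → (Fin 3 → ℂ)) (a : (Fin 3 → ℂ) → ℂ) (ha : AnalyticAt ℂ a 0)
    (h₁ : AnalyticAt ℂ (fun v => η (F v) 1) 0) (h₂ : AnalyticAt ℂ (fun v => η (F v) 2) 0)
    (h : ∀ v, (4 * v 0 ^ 3 + v 1 + 2 * v 2 * v 0) * a v + v 0 * η (F v) 1 +
      v 0 ^ 2 * η (F v) 2 = η (F v) 0) :
    Liftable F η := by
  refine ⟨fun v => ![a v, η (F v) 1, η (F v) 2], ?_, .of_forall fun v => ?_⟩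
  · rw [analyticAt_pi_iff]
    intro i
    fin_cases i
    · exact ha
    · exact h₁
    · exact h₂
  · rw [fderiv_swallowtail_unfolding_apply F hF]
    ext i
    fin_cases i
    · exact h v
    · rfl
    · rfl

/-- the three listed polynomial vector fields on `ℂ³` are liftable over
`F(x,y,z) = (x⁴+yx+zx², y, z)`. -/
theorem liftable_fields_of_swallowtail_unfolding
    (F : (Fin 3 → ℂ) → (Fin 3 → ℂ))
    (hF : ∀ v : Fin 3 → ℂ,
      F v = ![(v 0) ^ 4 + v 1 * v 0 + v 2 * (v 0) ^ 2, v 1, v 2]) :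
    Liftable F (fun V => ![4 * V 0, 3 * V 1, 2 * V 2]) ∧
    Liftable F (fun V => ![-9 * (V 1) ^ 2 - 16 * V 0 * V 2, 12 * V 1 * V 2,
      48 * V 0 + 4 * (V 2) ^ 2]) ∧
    Liftable F (fun V => ![V 1 * V 2, -8 * V 0 - 2 * (V 2) ^ 2, 6 * V 1]) := by
  refine ⟨liftable_swallowtail_unfolding_of_analyticAt F hF _ (fun v => v 0) ?_ ?_ ?_ ?_,
    liftable_swallowtail_unfolding_of_analyticAt F hF _
      (fun v => -12 * v 0 ^ 3 - 10 * v 2 * v 0 - 9 * v 1) ?_ ?_ ?_ ?_,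
    liftable_swallowtail_unfolding_of_analyticAt F hF _
      (fun v => 2 * v 0 ^ 2 + v 2) ?_ ?_ ?_ ?_⟩
  all_goals
    try simp only [hF, Matrix.cons_val]
    first
    | exact ContDiffAt.analyticAt (by fun_prop)
    | (intro v; ring)
end

section
/- Fix an integer k ≥ 1 and define h : ℂ³ → ℂ by h(X,Y,Z) = 256X³ + 27Y⁴ + 144XY²Z^k + 128X²Z^{2k} + 4Y²Z^{3k} + 16XZ^{4k}. Then for all (x,y,z) ∈ ℂ³ with 4x³ + y + 2z^k x = 0 one has h(x⁴+yx+z^k x², y, z) = 0. That is, h vanishes on the discriminant (the image of the critical set) of the map A^k f(x,y,z) = (x⁴+yx+z^k x², y, z). -/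
/-- the polynomial
`h(X,Y,Z) = 256X³ + 27Y⁴ + 144XY²Z^k + 128X²Z^{2k} + 4Y²Z^{3k} + 16XZ^{4k}`
vanishes on the discriminant of `A^k f(x,y,z) = (x⁴+yx+z^k x², y, z)`: whenever
`4x³ + y + 2z^k x = 0` one has `h(x⁴+yx+z^k x², y, z) = 0`. -/
theorem discriminant_equation_of_augmented_swallowtail
    (k : ℕ) (hk : 1 ≤ k)
    (h : ℂ → ℂ → ℂ → ℂ)
    (hh : ∀ X Y Z : ℂ, h X Y Z =
      256 * X ^ 3 + 27 * Y ^ 4 + 144 * X * Y ^ 2 * Z ^ k + 128 * X ^ 2 * Z ^ (2 * k)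
        + 4 * Y ^ 2 * Z ^ (3 * k) + 16 * X * Z ^ (4 * k)) :
    ∀ x y z : ℂ, 4 * x ^ 3 + y + 2 * z ^ k * x = 0 →
      h (x ^ 4 + y * x + z ^ k * x ^ 2) y z = 0 := by
  intro x y z hcrit
  have hy : y = -4 * x ^ 3 - 2 * z ^ k * x := by linear_combination hcrit
  rw [hh, mul_comm 2 k, mul_comm 3 k, mul_comm 4 k, pow_mul, pow_mul, pow_mul, hy]
  ring
end
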